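/- Consider equation (*) under (A0) with all coefficient and delay functions δ, p_j, a_j, τ_j, σ_j ω-periodic (ω > 0), and suppose p(t) > δ(t) for all t. Set D = ∫_0^ω δ(t) dt, γ = max_{t∈[0,ω]} p(t)/δ(t), and ζ⁺ = max_{1≤j≤m} limsup_{t→∞} ∫_{t−σ_j(t)}^t δ(s) ds. Assume (i) p(t) ≥ e^D δ(t) for all t ∈ [0,ω] with p(t) not identically equal to e^D δ(t), and (ii) (a⁺/a⁻) e^D (log γ)(e^{D+ζ⁺} − 1) ≤ 1. Then there exists a positive ω-periodic solution x* of (*) such that every positive solution x satisfies lim_{t→∞} (x(t) − x*(t)) = 0. -/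

import Mathlib

open Real Filter MeasureTheory Set

noncomputable section

/-- A positive (admissible) solution of the nonautonomous Nicholson equation (*)
`x'(t) = ∑ j, p j t * x (t - τd j t) * exp (-(a j t * x (t - σd j t))) - δ t * x t`,
considered for `t ≥ 0`, with nonnegative continuous initial data on `[-τ, 0)` and `x 0 > 0`. -/
def IsPosSol (m : ℕ) (p a : Fin m → ℝ → ℝ) (δ : ℝ → ℝ)
    (τd σd : Fin m → ℝ → ℝ) (τ : ℝ) (x : ℝ → ℝ) : Prop :=
  ContinuousOn x (Ici (-τ)) ∧
  (∀ θ ∈ Ico (-τ) (0:ℝ), 0 ≤ x θ) ∧ 0 < x 0 ∧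
  ∀ t ≥ (0:ℝ), HasDerivWithinAt x
      ((∑ j, p j t * x (t - τd j t) * Real.exp (-(a j t * x (t - σd j t)))) - δ t * x t)
      (Ici 0) t

/-- Hypothesis (A0): the coefficients `p j, a j, δ` are continuous and positive on `[0,∞)`;
the delays `τd j, σd j` are continuous, nonnegative and bounded; and each `a j` is bounded
below and above by positive constants. -/
def HypA0 (m : ℕ) (p a : Fin m → ℝ → ℝ) (δ : ℝ → ℝ)
    (τd σd : Fin m → ℝ → ℝ) : Prop :=
  (∀ j, ContinuousOn (p j) (Ici 0) ∧ ∀ t ≥ (0:ℝ), 0 < p j t) ∧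
  (∀ j, ContinuousOn (a j) (Ici 0) ∧
      ∃ c C : ℝ, 0 < c ∧ ∀ t ≥ (0:ℝ), c ≤ a j t ∧ a j t ≤ C) ∧
  (ContinuousOn δ (Ici 0) ∧ ∀ t ≥ (0:ℝ), 0 < δ t) ∧
  (∀ j, ContinuousOn (τd j) (Ici 0) ∧ ContinuousOn (σd j) (Ici 0) ∧
      (∀ t ≥ (0:ℝ), 0 ≤ τd j t ∧ 0 ≤ σd j t) ∧
      ∃ B : ℝ, ∀ t ≥ (0:ℝ), τd j t ≤ B ∧ σd j t ≤ B)

/-- `τ = max_j max (sup_t τd j t, sup_t σd j t)`: the supremum of all the delays. -/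
def IsMaxDelay (m : ℕ) (τd σd : Fin m → ℝ → ℝ) (τ : ℝ) : Prop :=
  IsLUB {r : ℝ | ∃ j : Fin m, ∃ t : ℝ, 0 ≤ t ∧ (r = τd j t ∨ r = σd j t)} τ

/-- Hypothesis (A1): `liminf_{t→∞} p(t)/δ(t) > 1` and `limsup_{t→∞} p(t)/δ(t) < ∞`. -/
def HypA1 (m : ℕ) (p : Fin m → ℝ → ℝ) (δ : ℝ → ℝ) : Prop :=
  1 < Filter.liminf (fun t => (∑ j, p j t) / δ t) Filter.atTop ∧
  Filter.IsBoundedUnder (· ≤ ·) Filter.atTop (fun t => (∑ j, p j t) / δ t)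

/-- Hypothesis (A2): `limsup_{t→∞} ∫_{t-τ}^t p(s) ds < ∞`. -/
def HypA2 (m : ℕ) (p : Fin m → ℝ → ℝ) (τ : ℝ) : Prop :=
  Filter.IsBoundedUnder (· ≤ ·) Filter.atTop (fun t => ∫ s in t - τ..t, (∑ j, p j s))

/-- Hypothesis (A3): `∫_0^∞ δ(s) ds = ∞`. -/
def HypA3 (δ : ℝ → ℝ) : Prop :=
  Filter.Tendsto (fun t => ∫ s in (0:ℝ)..t, δ s) Filter.atTop Filter.atTop


lemma anti_of_der {f f' : ℝ → ℝ} {a b : ℝ} (hab : a ≤ b)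
    (h : ∀ u ∈ Icc a b, HasDerivAt f (f' u) u) (h' : ∀ u ∈ Icc a b, f' u ≤ 0) : f b ≤ f a := by
  have : AntitoneOn f (Icc a b) := by
    apply antitoneOn_of_deriv_nonpos (convex_Icc a b)
    · exact fun u hu => (h u hu).continuousAt.continuousWithinAt
    · intro u hu
      exact (h u (interior_subset hu)).differentiableAt.differentiableWithinAt
    · intro u hu
      rw [(h u (interior_subset hu)).deriv]
      exact h' u (interior_subset hu)
  exact this (left_mem_Icc.2 hab) (right_mem_Icc.2 hab) hab

lemma mono_of_der {f f' : ℝ → ℝ} {a b : ℝ} (hab : a ≤ b)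
    (h : ∀ u ∈ Icc a b, HasDerivAt f (f' u) u) (h' : ∀ u ∈ Icc a b, 0 ≤ f' u) : f a ≤ f b := by
  have := anti_of_der (f := fun u => - f u) (f' := fun u => - f' u) hab
    (fun u hu => (h u hu).neg) (fun u hu => by linarith [h' u hu])
  linarith

/-- the derivative at a point which dominates the points on its left is nonnegative -/
lemma der_nonneg_of_left_max {f : ℝ → ℝ} {d a t : ℝ} (hat : a < t) (h : HasDerivAt f d t)
    (hmax : ∀ u ∈ Icc a t, f u ≤ f t) : 0 ≤ d := by
  have h1 := (hasDerivAt_iff_tendsto_slope.1 h).mono_left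
    (nhdsWithin_mono t (fun u (hu : u ∈ Iio t) => ne_of_lt hu))
  refine ge_of_tendsto h1 ?_
  have : Ioo a t ∈ nhdsWithin t (Iio t) := Ioo_mem_nhdsLT hat
  filter_upwards [this] with u hu
  rw [slope_def_field]
  apply div_nonneg_of_nonpos
  · linarith [hmax u ⟨hu.1.le, hu.2.le⟩]
  · linarith [hu.2]

lemma der_nonpos_of_left_min {f : ℝ → ℝ} {d a t : ℝ} (hat : a < t) (h : HasDerivAt f d t)
    (hmin : ∀ u ∈ Icc a t, f t ≤ f u) : d ≤ 0 := by
  have := der_nonneg_of_left_max (f := fun u => - f u) hat h.neg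
    (fun u hu => by linarith [hmin u hu])
  linarith

/-- fluctuation lemma -/
lemma fluct {f f' : ℝ → ℝ} {κ ε T : ℝ} (hε : 0 < ε)
    (h : ∀ u ≥ T, HasDerivAt f (f' u) u) (hfr : ∃ᶠ t in atTop, κ < f t) :
    ∃ t ≥ T, κ < f t ∧ -ε ≤ f' t := by
  by_contra! hcon
  obtain ⟨t0, ht0, hf0⟩ := (frequently_atTop.1 hfr) T
  have hex : ∃ t1 ≥ t0, f t1 ≤ κ := by
    by_contra! hall
    have key : ∀ t ≥ t0, f t + ε * t ≤ f t0 + ε * t0 := by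
      intro t ht
      refine anti_of_der (f := fun u => f u + ε * u) (f' := fun u => f' u + ε * 1) ht ?_ ?_
      · intro u hu
        exact (h u (ht0.trans hu.1)).add ((hasDerivAt_id u).const_mul ε)
      · intro u hu
        have := hcon u (ht0.trans hu.1) (hall u hu.1)
        linarith
    have h2 := key (t0 + (f t0 - κ) / ε) (by
      have : 0 ≤ (f t0 - κ) / ε := div_nonneg (by linarith) hε.le
      linarith)
    have h3 := hall (t0 + (f t0 - κ) / ε) (by
      have : 0 ≤ (f t0 - κ) / ε := div_nonneg (by linarith) hε.le
      linarith)
    have h4 : ε * ((f t0 - κ) / ε) = f t0 - κ := by field_simp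
    nlinarith
  obtain ⟨t1, ht1, hf1⟩ := hex
  obtain ⟨t2, ht2, hf2⟩ := (frequently_atTop.1 hfr) t1
  have hcont : ContinuousOn f (Icc t1 t2) := fun u hu =>
    (h u (ht0.trans (ht1.trans hu.1))).continuousAt.continuousWithinAt
  have hcomp : IsCompact (Icc t1 t2 ∩ f ⁻¹' Iic κ) :=
    isCompact_Icc.of_isClosed_subset (hcont.preimage_isClosed_of_isClosed isClosed_Icc isClosed_Iic)
      inter_subset_left
  obtain ⟨us, hus, hmax⟩ := hcomp.exists_isGreatest ⟨t1, ⟨le_rfl, ht2⟩, hf1⟩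
  have h5 : f t2 ≤ f us := by
    have hmono : AntitoneOn f (Icc us t2) := by
      apply antitoneOn_of_deriv_nonpos (convex_Icc us t2)
      · exact hcont.mono (Icc_subset_Icc_left hus.1.1)
      · intro u hu
        rw [interior_Icc] at hu
        exact (h u (ht0.trans (ht1.trans (hus.1.1.trans hu.1.le)))).differentiableAt.differentiableWithinAt
      · intro u hu
        rw [interior_Icc] at hu
        have huT : u ≥ T := ht0.trans (ht1.trans (hus.1.1.trans hu.1.le))
        rw [(h u huT).deriv]
        have : κ < f u := by
          by_contra! hle
          have := hmax ⟨⟨hus.1.1.trans hu.1.le, hu.2.le⟩, hle⟩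
          linarith [hu.1]
        linarith [hcon u huT this]
    exact hmono (left_mem_Icc.2 hus.1.2) (right_mem_Icc.2 hus.1.2) hus.1.2
  have h6 : f us ≤ κ := hus.2
  linarith

/-- pure algebra: the two fluctuation inequalities force `L ≤ 1`, `1 ≤ l`. -/
lemma exp_lt_aux {z : ℝ} (hz : 0 < z) : 2 * z / (2 + z) > 1 - exp (-z) := by
  -- (2 - z) / (2 + z) < exp (-z)
  have key : 0 ≤ (2 + z) * exp (-z) - (2 - z) := by
    have := mono_of_der (f := fun u => (2 + u) * exp (-u) - (2 - u))
      (f' := fun u => (1 * exp (-u) + (2 + u) * (exp (-u) * (-1))) - (0 - 1)) hz.le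
      (fun u _ => by
        have h1 : HasDerivAt (fun u : ℝ => exp (-u)) (exp (-u) * (-1)) u :=
          (hasDerivAt_neg u).exp
        have h2 : HasDerivAt (fun u : ℝ => 2 + u) 1 u := (hasDerivAt_id u).const_add 2
        exact (h2.mul h1).sub ((hasDerivAt_const u (2:ℝ)).sub (hasDerivAt_id u)))
      (fun u hu => by
        have h3 : u + 1 ≤ exp u := add_one_le_exp u
        have h4 : exp (-u) * exp u = 1 := by rw [← exp_add]; simp
        have h5 := exp_pos (-u)
        nlinarith [mul_le_mul_of_nonneg_left h3 h5.le])
    simpa using this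
  have strict : 0 < (2 + z) * exp (-z) - (2 - z) := by
    -- use the half point and strictness of the derivative
    have := strictMonoOn_of_deriv_pos (convex_Icc 0 z) (f := fun u => (2 + u) * exp (-u) - (2 - u))
      (by fun_prop) (by
        intro u hu
        rw [interior_Icc] at hu
        have h1 : HasDerivAt (fun u : ℝ => exp (-u)) (exp (-u) * (-1)) u :=
          (hasDerivAt_neg u).exp
        have h2 : HasDerivAt (fun u : ℝ => 2 + u) 1 u := (hasDerivAt_id u).const_add 2
        have h0 := ((h2.mul h1).sub ((hasDerivAt_const u (2:ℝ)).sub (hasDerivAt_id u))).deriv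
        have h0' : deriv (fun u => (2 + u) * exp (-u) - (2 - u)) u =
          (1 * exp (-u) + (2 + u) * (exp (-u) * (-1))) - (0 - 1) := h0
        rw [h0']
        have h3 : u + 1 < exp u := add_one_lt_exp hu.1.ne'
        have h4 : exp (-u) * exp u = 1 := by rw [← exp_add]; simp
        have h5 := exp_pos (-u)
        nlinarith [mul_lt_mul_of_pos_left h3 h5])
    have := this (left_mem_Icc.2 hz.le) (right_mem_Icc.2 hz.le) hz
    simpa using this
  rw [gt_iff_lt, lt_div_iff₀ (by linarith)]
  nlinarith

lemma exp_lt_aux2 {z : ℝ} (hz : 0 < z) (hz2 : z < 2) : exp z - 1 < 2 * z / (2 - z) := by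
  have h := exp_lt_aux hz
  rw [gt_iff_lt, lt_div_iff₀ (by linarith)] at h
  rw [lt_div_iff₀ (by linarith)]
  have h4 : exp (-z) * exp z = 1 := by rw [← exp_add]; simp
  have h5 := exp_pos z
  nlinarith [mul_lt_mul_of_pos_left h h5]

lemma algebra_aux {L l K s : ℝ} (hl : 0 < l) (_hlL : l ≤ L) (hs : 0 ≤ s) (hK0 : 0 ≤ K)
    (hK : K * (exp s - 1) ≤ 1)
    (I1 : 1 < L → L ≤ L * exp (K * max (1 - l) 0) + (1 - L * exp (K * max (1 - l) 0)) * exp (-s))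
    (I2 : l < 1 → l * exp (-(K * max (L - 1) 0)) + (1 - l * exp (-(K * max (L - 1) 0))) * exp (-s)
      ≤ l) : L ≤ 1 ∧ 1 ≤ l := by
  have e1 : exp (-s) * exp s = 1 := by rw [← exp_add]; simp
  have es : 0 < exp s := exp_pos s
  have ens : 0 < exp (-s) := exp_pos _
  set q := exp s - 1 with hq
  have hq0 : 0 ≤ q := by have := add_one_le_exp s; linarith
  -- multiplied forms
  have J1 : 1 < L → (1 + q) * L ≤ 1 + q * (L * exp (K * max (1 - l) 0)) := by
    intro h
    have h9 := mul_le_mul_of_nonneg_right (I1 h) es.le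
    have e2 : exp s = 1 + q := by rw [hq]; ring
    generalize L * exp (K * max (1 - l) 0) = W at *
    have r : (W + (1 - W) * exp (-s)) * exp s = W * exp s + (1 - W) := by
      linear_combination (1 - W) * e1
    rw [r, e2] at h9
    linarith
  have J2 : l < 1 → 1 + q * (l * exp (-(K * max (L - 1) 0))) ≤ (1 + q) * l := by
    intro h
    have h9 := mul_le_mul_of_nonneg_right (I2 h) es.le
    have e2 : exp s = 1 + q := by rw [hq]; ring
    generalize l * exp (-(K * max (L - 1) 0)) = W at *
    have r : (W + (1 - W) * exp (-s)) * exp s = W * exp s + (1 - W) := by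
      linear_combination (1 - W) * e1
    rw [r, e2] at h9
    linarith
  have main : ¬ (1 < L ∧ l < 1) := by
    rintro ⟨h1, h2⟩
    have j1 := J1 h1
    have j2 := J2 h2
    rw [max_eq_left (by linarith)] at j1 j2
    obtain hq00 | hqpos := hq0.eq_or_lt
    · rw [← hq00] at j1; linarith
    have hKq : K ≤ 1 / q := by rw [le_div_iff₀ hqpos]; exact hK
    set X := L - 1 with hX
    set Y := 1 - l with hY
    have hXp : 0 < X := by linarith
    have hYp : 0 < Y := by linarith
    have k1 : exp (K * Y) ≤ exp (Y / q) := by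
      apply exp_le_exp.2
      calc K * Y ≤ 1 / q * Y := by gcongr
        _ = Y / q := by ring
    have k2 : exp (-(X / q)) ≤ exp (-(K * X)) := by
      apply exp_le_exp.2
      have : K * X ≤ 1 / q * X := by gcongr
      have h3 : 1 / q * X = X / q := by ring
      linarith
    have a2 := exp_lt_aux (div_pos hXp hqpos)
    have hLe : L = 1 + X := by rw [hX]; ring
    have hle : l = 1 - Y := by rw [hY]; ring
    -- second inequality
    have m2 : Y ≤ q * (l * (1 - exp (-(X / q)))) := by
      have : q * (l * exp (-(X / q))) ≤ q * (l * exp (-(K * X))) := by gcongr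
      nlinarith
    have m2' : Y * (2 * q + X) < 2 * q * X * l := by
      have h3 : q * (l * (1 - exp (-(X / q)))) < q * (l * (2 * (X / q) / (2 + X / q))) := by
        gcongr
      have h4 : q * (l * (2 * (X / q) / (2 + X / q))) * (2 * q + X) = 2 * q * X * l := by
        field_simp
      have h5 := mul_lt_mul_of_pos_right (m2.trans_lt h3) (show 0 < 2 * q + X by positivity)
      linarith
    have hYq : Y < 2 * q := by
      have h6 : exp (-(X / q)) > 0 := exp_pos _
      have h7 : q * (l * (1 - exp (-(X / q)))) ≤ q * (1 * 1) := by
        gcongr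
        · have : exp (-(X / q)) ≤ 1 := exp_le_one_iff.2 (by have := div_pos hXp hqpos; linarith)
          linarith
        · linarith
      linarith
    have a1 := exp_lt_aux2 (div_pos hYp hqpos) (by rw [div_lt_iff₀ hqpos]; exact hYq)
    have m1 : X ≤ q * (L * (exp (Y / q) - 1)) := by
      have : q * (L * exp (K * Y)) ≤ q * (L * exp (Y / q)) := by gcongr
      nlinarith
    have m1' : X * (2 * q - Y) < 2 * q * Y * L := by
      have h3 : q * (L * (exp (Y / q) - 1)) < q * (L * (2 * (Y / q) / (2 - Y / q))) := by
        gcongr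
      have h4 : q * (L * (2 * (Y / q) / (2 - Y / q))) * (2 * q - Y) = 2 * q * Y * L := by
        have : 2 - Y / q = (2 * q - Y) / q := by field_simp
        rw [this]
        have h8 : 2 * q - Y ≠ 0 := by linarith
        have h10 : q ≠ 0 := hqpos.ne'
        generalize 2 * q - Y = V at *
        field_simp
      have h5 := mul_lt_mul_of_pos_right (m1.trans_lt h3) (show 0 < 2 * q - Y by linarith)
      linarith
    rw [hLe] at m1'
    rw [hle] at m2'
    nlinarith
  constructor
  · by_contra! h
    have hl1 : 1 ≤ l := by by_contra! h'; exact main ⟨h, h'⟩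
    have := J1 h
    rw [max_eq_right (by linarith)] at this
    simp at this
    nlinarith
  · by_contra! h
    have hl1 : L ≤ 1 := by by_contra! h'; exact main ⟨h', h⟩
    have := J2 h
    rw [max_eq_right (by linarith)] at this
    simp at this
    nlinarith


/-- the system satisfied by the quotient of a positive solution by a periodic one -/
structure YSys (m : ℕ) (c b τd σd : Fin m → ℝ → ℝ) (y E : ℝ → ℝ)
    (τ K s c0 c1 b0 : ℝ) : Prop where
  hm : 0 < m
  hτ : 0 ≤ τ
  hc0 : 0 < c0
  hb0 : 0 < b0
  hs : 0 ≤ s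
  hc : ∀ j, ∀ t ≥ (0:ℝ), c0 ≤ c j t
  hC : ∀ t ≥ (0:ℝ), ∑ j, c j t ≤ c1
  hb : ∀ j, ∀ t ≥ (0:ℝ), b0 ≤ b j t ∧ b j t ≤ K
  hd : ∀ j, ∀ t ≥ (0:ℝ), (0 ≤ τd j t ∧ τd j t ≤ τ) ∧ (0 ≤ σd j t ∧ σd j t ≤ τ)
  cont : ContinuousOn y (Ici (-τ))
  nonneg : ∀ t ≥ -τ, 0 ≤ y t
  pos : ∀ t ≥ (0:ℝ), 0 < y t
  der : ∀ t > (0:ℝ), HasDerivAt y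
    (∑ j, c j t * (y (t - τd j t) * exp (-(b j t * (y (t - σd j t) - 1))) - y t)) t
  Epos : ∀ t ≥ (0:ℝ), 0 < E t
  Eder : ∀ t > (0:ℝ), HasDerivAt E ((∑ j, c j t) * E t) t
  Es : ∀ t ≥ τ + 1, ∀ j, E t ≤ exp s * E (t - σd j t)
  hK : K * (exp s - 1) ≤ 1

namespace YSys
variable {m : ℕ} {c b τd σd : Fin m → ℝ → ℝ} {y E : ℝ → ℝ} {τ K s c0 c1 b0 : ℝ}

lemma c_pos (h : YSys m c b τd σd y E τ K s c0 c1 b0) (j) {t : ℝ} (ht : 0 ≤ t) : 0 < c j t :=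
  lt_of_lt_of_le h.hc0 (h.hc j t ht)

lemma C_nonneg (h : YSys m c b τd σd y E τ K s c0 c1 b0) {t : ℝ} (ht : 0 ≤ t) :
    0 ≤ ∑ j, c j t := Finset.sum_nonneg fun j _ => (h.c_pos j ht).le

lemma K_pos (h : YSys m c b τd σd y E τ K s c0 c1 b0) : 0 < K := by
  have := h.hb ⟨0, h.hm⟩ 0 le_rfl
  linarith [h.hb0]

lemma c1_nonneg (h : YSys m c b τd σd y E τ K s c0 c1 b0) : 0 ≤ c1 :=
  (h.C_nonneg le_rfl).trans (h.hC 0 le_rfl)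

lemma E_mono (h : YSys m c b τd σd y E τ K s c0 c1 b0) {t0 t : ℝ} (h0 : 0 < t0) (ht : t0 ≤ t) :
    E t0 ≤ E t :=
  mono_of_der ht (fun u hu => h.Eder u (h0.trans_le hu.1)) (fun u hu =>
    mul_nonneg (h.C_nonneg (h0.le.trans hu.1)) (h.Epos u (h0.le.trans hu.1)).le)

lemma comp_der (h : YSys m c b τd σd y E τ K s c0 c1 b0) (Q : ℝ) {u : ℝ} (hu : 0 < u) :
    HasDerivAt (fun u => (y u - Q) * E u)
      (E u * ∑ j, c j u * (y (u - τd j u) * exp (-(b j u * (y (u - σd j u) - 1))) - Q)) u := by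
  have h1 := ((h.der u hu).sub_const Q).mul (h.Eder u hu)
  refine h1.congr_deriv ?_
  simp only [mul_sub, Finset.sum_sub_distrib, ← Finset.sum_mul]
  ring

lemma comp_up (h : YSys m c b τd σd y E τ K s c0 c1 b0) {Q t0 t : ℝ} (h0 : 0 < t0) (ht : t0 ≤ t)
    (hQ : ∀ u ∈ Icc t0 t, ∀ j, y (u - τd j u) * exp (-(b j u * (y (u - σd j u) - 1))) ≤ Q) :
    (y t - Q) * E t ≤ (y t0 - Q) * E t0 :=
  anti_of_der (f := fun u => (y u - Q) * E u) ht (fun u hu => h.comp_der Q (h0.trans_le hu.1))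
    (fun u hu => mul_nonpos_of_nonneg_of_nonpos (h.Epos u (h0.le.trans hu.1)).le
      (Finset.sum_nonpos fun j _ => mul_nonpos_of_nonneg_of_nonpos
        (h.c_pos j (h0.le.trans hu.1)).le (by linarith [hQ u hu j])))

lemma comp_lo (h : YSys m c b τd σd y E τ K s c0 c1 b0) {Q t0 t : ℝ} (h0 : 0 < t0) (ht : t0 ≤ t)
    (hQ : ∀ u ∈ Icc t0 t, ∀ j, Q ≤ y (u - τd j u) * exp (-(b j u * (y (u - σd j u) - 1)))) :
    (y t0 - Q) * E t0 ≤ (y t - Q) * E t :=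
  mono_of_der (f := fun u => (y u - Q) * E u) ht (fun u hu => h.comp_der Q (h0.trans_le hu.1))
    (fun u hu => mul_nonneg (h.Epos u (h0.le.trans hu.1)).le
      (Finset.sum_nonneg fun j _ => mul_nonneg
        (h.c_pos j (h0.le.trans hu.1)).le (by linarith [hQ u hu j])))

/-- `y` cannot decay faster than `exp (- c1 t)` -/
lemma decay (h : YSys m c b τd σd y E τ K s c0 c1 b0) {t0 t : ℝ} (h0 : 0 < t0) (ht : t0 ≤ t) :
    y t0 ≤ y t * exp (c1 * (t - t0)) := by
  have key := mono_of_der (f := fun u => y u * exp (c1 * (u - t0)))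
    (f' := fun u => (∑ j, c j u * (y (u - τd j u) * exp (-(b j u * (y (u - σd j u) - 1))) - y u)) *
      exp (c1 * (u - t0)) + y u * (exp (c1 * (u - t0)) * (c1 * 1))) ht
    (fun u hu => (h.der u (h0.trans_le hu.1)).mul
      ((((hasDerivAt_id u).sub_const t0).const_mul c1).exp))
    (fun u hu => by
      have hu0 : 0 ≤ u := h0.le.trans hu.1
      have e := exp_pos (c1 * (u - t0))
      have h1 : -(c1 * y u) ≤
          ∑ j, c j u * (y (u - τd j u) * exp (-(b j u * (y (u - σd j u) - 1))) - y u) := by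
        have h2 : ∑ j, c j u * (0 - y u) ≤
          ∑ j, c j u * (y (u - τd j u) * exp (-(b j u * (y (u - σd j u) - 1))) - y u) := by
          apply Finset.sum_le_sum
          intro j _
          apply mul_le_mul_of_nonneg_left _ (h.c_pos j hu0).le
          have : 0 ≤ y (u - τd j u) := h.nonneg _ (by linarith [(h.hd j u hu0).1.2])
          have := mul_nonneg this (exp_pos (-(b j u * (y (u - σd j u) - 1)))).le
          linarith
        rw [← Finset.sum_mul] at h2
        nlinarith [h.hC u hu0, h.pos u hu0]
      nlinarith)
  simpa using key

lemma upper (h : YSys m c b τd σd y E τ K s c0 c1 b0) : ∃ B, ∀ t ≥ -τ, y t ≤ B := by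
  set lam := c1 * exp K + 1 with hlam
  have hlp : 0 < lam := by have := h.c1_nonneg; positivity
  set B0 := exp (c1 * τ) * exp (lam * τ) * exp (lam * τ) with hB0
  have hcomp : IsCompact (Icc (-τ) (2 * τ + 1)) := isCompact_Icc
  obtain ⟨B1, hB1⟩ := (hcomp.image_of_continuousOn (h.cont.mono Icc_subset_Ici_self)).bddAbove
  refine ⟨max B0 B1, ?_⟩
  by_contra! hcon
  obtain ⟨t1, ht1, hy1⟩ := hcon
  have hB1' : ∀ t ∈ Icc (-τ) (2 * τ + 1), y t ≤ B1 := fun t ht => hB1 (mem_image_of_mem y ht)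
  obtain ⟨ts, hts, hmax⟩ := (isCompact_Icc (a := -τ) (b := t1)).exists_isMaxOn
    ⟨t1, ht1, le_rfl⟩ (h.cont.mono Icc_subset_Ici_self)
  have hmax' : ∀ u ∈ Icc (-τ) t1, y u ≤ y ts := fun u hu => hmax hu
  have hyts : max B0 B1 < y ts := hy1.trans_le (hmax' t1 ⟨ht1, le_rfl⟩)
  have hts2 : 2 * τ + 1 < ts := by
    by_contra! hle
    have := hB1' ts ⟨hts.1, hle⟩
    linarith [le_max_right B0 B1]
  have hτ := h.hτ
  have hts0 : 0 < ts := by linarith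
  have hd := der_nonneg_of_left_max (a := -τ) (by linarith) (h.der ts hts0)
    (fun u hu => hmax' u ⟨hu.1, hu.2.trans hts.2⟩)
  obtain ⟨j, -, hj⟩ : ∃ j ∈ Finset.univ, 0 ≤ c j ts * (y (ts - τd j ts) *
      exp (-(b j ts * (y (ts - σd j ts) - 1))) - y ts) := by
    have : (Finset.univ : Finset (Fin m)).Nonempty := ⟨⟨0, h.hm⟩, Finset.mem_univ _⟩
    by_contra! hneg
    have := Finset.sum_lt_sum_of_nonempty this hneg
    simp only [Finset.sum_const_zero] at this
    linarith
  have hdj := h.hd j ts hts0.le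
  have hj2 : y ts ≤ y (ts - τd j ts) * exp (-(b j ts * (y (ts - σd j ts) - 1))) := by
    have := (mul_nonneg_iff_of_pos_left (h.c_pos j hts0.le)).1 hj
    linarith
  have hj3 : y (ts - τd j ts) ≤ y ts := hmax' _ ⟨by linarith [hdj.1.2], by linarith [hdj.1.1, hts.2]⟩
  have hyts0 := h.pos ts hts0.le
  have hj4 : y (ts - σd j ts) ≤ 1 := by
    by_contra! hgt
    have h1 : exp (-(b j ts * (y (ts - σd j ts) - 1))) < 1 := by
      rw [exp_lt_one_iff]
      have : 0 < b j ts := h.hb0.trans_le (h.hb j ts hts0.le).1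
      nlinarith
    have h2 := exp_pos (-(b j ts * (y (ts - σd j ts) - 1)))
    nlinarith
  set t0 := ts - σd j ts with ht0
  have ht00 : τ + 1 < t0 := by linarith [hdj.2.2]
  have hpre : ∀ u ∈ Icc (t0 - τ) t0, y u ≤ exp (c1 * τ) := by
    intro u hu
    have h1 := h.decay (t0 := u) (t := t0) (by linarith [hu.1]) hu.2
    calc y u ≤ y t0 * exp (c1 * (t0 - u)) := h1
      _ ≤ 1 * exp (c1 * τ) := by
        have hc1 := h.c1_nonneg
        gcongr
        linarith [hu.1]
      _ = _ := one_mul _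
  -- exponential growth bound
  have hφc : ContinuousOn (fun u => y u * exp (-(lam * (u - t0)))) (Icc (t0 - τ) ts) := by
    apply ContinuousOn.mul
    · exact h.cont.mono (fun u hu => by simp only [mem_Ici]; linarith [hu.1])
    · fun_prop
  obtain ⟨us, hus, hum⟩ := (isCompact_Icc (a := t0 - τ) (b := ts)).exists_isMaxOn
    ⟨ts, by linarith [hdj.2.1], le_rfl⟩ hφc
  have hum' : ∀ u ∈ Icc (t0 - τ) ts, y u * exp (-(lam * (u - t0))) ≤
    y us * exp (-(lam * (us - t0))) := fun u hu => hum hu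
  have hle : us ≤ t0 := by
    by_contra! hgt
    have hus0 : 0 < us := by linarith
    have hder := (h.der us hus0).mul
      (((((hasDerivAt_id us).sub_const t0).const_mul lam).neg).exp)
    have h1 := der_nonneg_of_left_max (a := t0 - τ) (by linarith) hder
      (fun u hu => hum' u ⟨hu.1, hu.2.trans hus.2⟩)
    have hyus := h.pos us hus0.le
    have hpast : ∀ v ∈ Icc (t0 - τ) us, y v ≤ y us := by
      intro v hv
      have h2 := hum' v ⟨hv.1, hv.2.trans hus.2⟩
      have h3 : exp (-(lam * (us - t0))) ≤ exp (-(lam * (v - t0))) := by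
        apply exp_le_exp.2
        nlinarith [hv.2]
      have h4 := exp_pos (-(lam * (us - t0)))
      have h5 := h.nonneg v (by linarith [hv.1])
      by_contra! hlt
      nlinarith
    have hsum : ∑ i, c i us * (y (us - τd i us) * exp (-(b i us * (y (us - σd i us) - 1))) - y us)
        ≤ c1 * (exp K * y us) := by
      have h6 : ∑ i, c i us * (y (us - τd i us) * exp (-(b i us * (y (us - σd i us) - 1))) - y us)
          ≤ ∑ i, c i us * (exp K * y us) := by
        apply Finset.sum_le_sum
        intro i _
        apply mul_le_mul_of_nonneg_left _ (h.c_pos i hus0.le).le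
        have hdi := h.hd i us hus0.le
        have hbi := h.hb i us hus0.le
        have h7 : y (us - τd i us) ≤ y us := hpast _ ⟨by linarith, by linarith⟩
        have h8 : 0 ≤ y (us - σd i us) := h.nonneg _ (by linarith)
        have h9 : exp (-(b i us * (y (us - σd i us) - 1))) ≤ exp K := by
          apply exp_le_exp.2
          nlinarith [h.hb0]
        have h10 : 0 ≤ y (us - τd i us) := h.nonneg _ (by linarith)
        have h11 := mul_le_mul h7 h9 (exp_pos _).le hyus.le
        linarith
      rw [← Finset.sum_mul] at h6
      have h12 := mul_le_mul_of_nonneg_right (h.hC us hus0.le)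
        (show 0 ≤ exp K * y us by positivity)
      linarith
    have h4 := exp_pos (-(lam * (us - t0)))
    simp only [id, mul_one, Pi.neg_apply] at h1
    have h13 : (∑ i, c i us * (y (us - τd i us) * exp (-(b i us * (y (us - σd i us) - 1))) - y us)
        - lam * y us) * exp (-(lam * (us - t0))) ≥ 0 := by
      nlinarith
    have h14 : ∑ i, c i us * (y (us - τd i us) * exp (-(b i us * (y (us - σd i us) - 1))) - y us)
        - lam * y us < 0 := by
      rw [hlam]; nlinarith
    nlinarith
  have hfin : y ts ≤ B0 := by
    have h1 := hum' ts ⟨by linarith [hdj.2.1], le_rfl⟩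
    have h2 := hpre us ⟨hus.1, hle⟩
    have h3 : exp (-(lam * (us - t0))) ≤ exp (lam * τ) := by
      apply exp_le_exp.2
      nlinarith [hus.1]
    have h4 : exp (-(lam * τ)) ≤ exp (-(lam * (ts - t0))) := by
      apply exp_le_exp.2
      nlinarith [hdj.2.2]
    have h5 : y ts * exp (-(lam * τ)) ≤ exp (c1 * τ) * exp (lam * τ) := by
      calc y ts * exp (-(lam * τ)) ≤ y ts * exp (-(lam * (ts - t0))) := by gcongr
        _ ≤ _ := h1
        _ ≤ _ := by gcongr
    have h6 : exp (-(lam * τ)) * exp (lam * τ) = 1 := by rw [← exp_add]; simp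
    calc y ts = y ts * exp (-(lam * τ)) * exp (lam * τ) := by rw [mul_assoc, h6, mul_one]
      _ ≤ _ := by rw [hB0]; gcongr
  linarith [le_max_left B0 B1]

lemma lower (h : YSys m c b τd σd y E τ K s c0 c1 b0) : ∃ r > 0, ∀ t ≥ 0, r ≤ y t := by
  have hτ := h.hτ
  have hc1 := h.c1_nonneg
  obtain ⟨t2, ht2, hmin2⟩ := (isCompact_Icc (a := (0:ℝ)) (b := 2 * τ + 1)).exists_isMinOn
    ⟨0, le_rfl, by linarith⟩ (h.cont.mono (fun u hu => by simp only [mem_Ici]; linarith [hu.1]))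
  have hmin2' : ∀ u ∈ Icc (0:ℝ) (2 * τ + 1), y t2 ≤ y u := fun u hu => hmin2 hu
  refine ⟨min (exp (-(c1 * τ))) (y t2), lt_min (exp_pos _) (h.pos t2 ht2.1), ?_⟩
  by_contra! hcon
  obtain ⟨t1, ht1, hy1⟩ := hcon
  obtain ⟨ts, hts, hmin⟩ := (isCompact_Icc (a := (0:ℝ)) (b := t1)).exists_isMinOn
    ⟨t1, ht1, le_rfl⟩ (h.cont.mono (fun u hu => by simp only [mem_Ici]; linarith [hu.1]))
  have hmin' : ∀ u ∈ Icc (0:ℝ) t1, y ts ≤ y u := fun u hu => hmin hu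
  have hyts : y ts < min (exp (-(c1 * τ))) (y t2) := (hmin' t1 ⟨ht1, le_rfl⟩).trans_lt hy1
  have hts2 : 2 * τ + 1 < ts := by
    by_contra! hle
    have := hmin2' ts ⟨hts.1, hle⟩
    linarith [min_le_right (exp (-(c1 * τ))) (y t2)]
  have hts0 : 0 < ts := by linarith
  have hd := der_nonpos_of_left_min (a := 0) (by linarith) (h.der ts hts0)
    (fun u hu => hmin' u ⟨hu.1, hu.2.trans hts.2⟩)
  obtain ⟨j, -, hj⟩ : ∃ j ∈ Finset.univ, c j ts * (y (ts - τd j ts) *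
      exp (-(b j ts * (y (ts - σd j ts) - 1))) - y ts) ≤ 0 := by
    have : (Finset.univ : Finset (Fin m)).Nonempty := ⟨⟨0, h.hm⟩, Finset.mem_univ _⟩
    by_contra! hneg
    have := Finset.sum_lt_sum_of_nonempty this hneg
    simp only [Finset.sum_const_zero] at this
    linarith
  have hdj := h.hd j ts hts0.le
  have hj2 : y (ts - τd j ts) * exp (-(b j ts * (y (ts - σd j ts) - 1))) ≤ y ts := by
    by_contra! hgt
    have := mul_pos (h.c_pos j hts0.le) (sub_pos.2 hgt)
    linarith
  have hj3 : y ts ≤ y (ts - τd j ts) := hmin' _ ⟨by linarith [hdj.1.2], by linarith [hdj.1.1, hts.2]⟩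
  have hyts0 := h.pos ts hts0.le
  have hj4 : 1 ≤ y (ts - σd j ts) := by
    by_contra! hgt
    have h1 : 1 < exp (-(b j ts * (y (ts - σd j ts) - 1))) := by
      rw [one_lt_exp_iff]
      have : 0 < b j ts := h.hb0.trans_le (h.hb j ts hts0.le).1
      nlinarith
    nlinarith
  have h1 := h.decay (t0 := ts - σd j ts) (t := ts) (by linarith [hdj.2.2]) (by linarith [hdj.2.1])
  have h2 : y ts * exp (c1 * (ts - (ts - σd j ts))) ≤ y ts * exp (c1 * τ) := by
    gcongr
    linarith [hdj.2.2]
  have h6 : exp (-(c1 * τ)) * exp (c1 * τ) = 1 := by rw [← exp_add]; simp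
  have h7 : y ts < exp (-(c1 * τ)) := hyts.trans_le (min_le_left _ _)
  have h8 := mul_lt_mul_of_pos_right h7 (exp_pos (c1 * τ))
  linarith

end YSys


namespace YSys
variable {m : ℕ} {c b τd σd : Fin m → ℝ → ℝ} {y E : ℝ → ℝ} {τ K s c0 c1 b0 : ℝ}

lemma ineq1 (h : YSys m c b τd σd y E τ K s c0 c1 b0) {L l : ℝ}
    (hL1 : ∀ ε > 0, ∀ᶠ t in atTop, y t < L + ε) (hL2 : ∀ ε > 0, ∃ᶠ t in atTop, L - ε < y t)
    (hl1 : ∀ ε > 0, ∀ᶠ t in atTop, l - ε < y t) (hL : 1 < L) :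
    L ≤ L * exp (K * max (1 - l) 0) + (1 - L * exp (K * max (1 - l) 0)) * exp (-s) := by
  set Q : ℝ → ℝ := fun ε => (L + ε) * exp (K * max (1 - l + ε) 0) with hQ
  set η : ℝ → ℝ := fun ε => (2 * ε + ε / c0) / (b0 * (L - ε - ε / c0)) with hη
  have hc0 := h.hc0
  have hb0 := h.hb0
  have hτ := h.hτ
  have hKp := h.K_pos
  have hQt : Tendsto Q (nhdsWithin 0 (Ioi 0)) (nhds (L * exp (K * max (1 - l) 0))) := by
    have : ContinuousAt Q 0 := by fun_prop
    have h2 := this.tendsto.mono_left (nhdsWithin_le_nhds (s := Ioi 0))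
    simpa [hQ] using h2
  have hηt : Tendsto η (nhdsWithin 0 (Ioi 0)) (nhds 0) := by
    have : ContinuousAt η 0 := by
      apply ContinuousAt.div (by fun_prop) (by fun_prop)
      simp; exact ⟨hb0.ne', by linarith⟩
    have h2 := this.tendsto.mono_left (nhdsWithin_le_nhds (s := Ioi 0))
    simpa [hη] using h2
  have hQ0 : 1 < L * exp (K * max (1 - l) 0) := by
    have : 1 ≤ exp (K * max (1 - l) 0) := one_le_exp (by positivity)
    nlinarith
  have ev1 : ∀ᶠ ε in nhdsWithin (0:ℝ) (Ioi 0), 1 + η ε < Q ε := by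
    have : Tendsto (fun ε => 1 + η ε) (nhdsWithin 0 (Ioi 0)) (nhds (1 + 0)) := hηt.const_add 1
    exact this.eventually_lt hQt (by simpa using hQ0)
  have ev2 : ∀ᶠ ε in nhdsWithin (0:ℝ) (Ioi 0), 0 < L - ε - ε / c0 := by
    have : ContinuousAt (fun ε => L - ε - ε / c0) 0 := by fun_prop
    have h2 := this.tendsto.mono_left (nhdsWithin_le_nhds (s := Ioi 0))
    exact h2.eventually (lt_mem_nhds (by simp; linarith))
  have hlim1 : Tendsto (fun ε : ℝ => L - ε) (nhdsWithin 0 (Ioi 0)) (nhds L) := by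
    have : ContinuousAt (fun ε : ℝ => L - ε) 0 := by fun_prop
    have h2 := this.tendsto.mono_left (nhdsWithin_le_nhds (s := Ioi 0))
    simpa using h2
  have hlim2 : Tendsto (fun ε : ℝ => Q ε + (1 + η ε - Q ε) * exp (-s)) (nhdsWithin 0 (Ioi 0))
      (nhds (L * exp (K * max (1 - l) 0) + (1 + 0 - L * exp (K * max (1 - l) 0)) * exp (-s))) :=
    hQt.add (((hηt.const_add 1).sub hQt).mul_const _)
  rw [add_zero] at hlim2
  refine le_of_tendsto_of_tendsto hlim1 hlim2 ?_
  filter_upwards [ev1, ev2, self_mem_nhdsWithin] with ε he1 he2 (hε : 0 < ε)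
  obtain ⟨T, hT⟩ := eventually_atTop.1 ((hL1 ε hε).and (hl1 ε hε))
  set T' := max T 0 + 2 * τ + 1 with hT'
  have hT0 := le_max_right T 0
  have hTT := le_max_left T 0
  obtain ⟨t, htT, hyt, hdt⟩ := fluct (κ := L - ε) (T := T') hε
    (fun u hu => h.der u (by linarith)) (hL2 ε hε)
  have ht0 : 0 ≤ t := by linarith
  obtain ⟨j, hj⟩ : ∃ j, -ε ≤ c j t * (y (t - τd j t) *
      exp (-(b j t * (y (t - σd j t) - 1))) - y t) := by
    have hne : (Finset.univ : Finset (Fin m)).Nonempty := ⟨⟨0, h.hm⟩, Finset.mem_univ _⟩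
    by_contra! hneg
    have h1 := Finset.sum_lt_sum_of_nonempty hne (fun i _ => hneg i)
    simp only [Finset.sum_const, Finset.card_univ, Fintype.card_fin, nsmul_eq_mul] at h1
    have h2 : (1:ℝ) ≤ m := by exact_mod_cast h.hm
    nlinarith
  have hdj := h.hd j t ht0
  have hbj := h.hb j t ht0
  have hcj := h.hc j t ht0
  have hj2 : y t - ε / c0 ≤ y (t - τd j t) * exp (-(b j t * (y (t - σd j t) - 1))) := by
    by_contra! hlt
    have h1 : ε / c0 * c0 = ε := by field_simp
    have h2 : ε / c0 < y t - y (t - τd j t) * exp (-(b j t * (y (t - σd j t) - 1))) := by linarith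
    have h3 : 0 < ε / c0 := by positivity
    nlinarith
  have hyτ : y (t - τd j t) ≤ L + ε := (hT _ (by linarith)).1.le
  have hw : y (t - σd j t) - 1 ≤ η ε := by
    have hη0 : 0 ≤ η ε := by
      rw [hη]; positivity
    by_contra! hgt
    set w := y (t - σd j t) - 1 with hw
    have hwp : 0 < w := by linarith
    have e1 : exp (-(b j t * w)) * exp (b j t * w) = 1 := by rw [← exp_add]; simp
    have e2 : 1 + b0 * w ≤ exp (b j t * w) := by
      have := add_one_le_exp (b j t * w)
      nlinarith
    have e3 := exp_pos (-(b j t * w))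
    have e4 : L - ε - ε / c0 < (L + ε) * exp (-(b j t * w)) := by nlinarith
    have e6 : 0 < L + ε := by linarith
    have e5 : (L - ε - ε / c0) * (1 + b0 * w) < L + ε := by
      calc (L - ε - ε / c0) * (1 + b0 * w) ≤ (L - ε - ε / c0) * exp (b j t * w) := by gcongr
        _ < (L + ε) * exp (-(b j t * w)) * exp (b j t * w) := by gcongr
        _ = L + ε := by rw [mul_assoc, e1, mul_one]
    have e7 : w < η ε := by
      rw [hη]
      simp only
      rw [lt_div_iff₀ (by positivity)]
      linarith
    linarith
  have hσ0 : 0 < t - σd j t := by linarith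
  have hcmp := h.comp_up (Q := Q ε) (t0 := t - σd j t) (t := t) hσ0 (by linarith) (by
    intro u hu i
    have hu0 : 0 ≤ u := by linarith [hu.1]
    have hdi := h.hd i u hu0
    have hbi := h.hb i u hu0
    have hut : u ≥ t - τ := by linarith [hu.1]
    have h1 := (hT (u - τd i u) (by linarith)).1
    have h2 := (hT (u - σd i u) (by linarith)).2
    have h3 : exp (-(b i u * (y (u - σd i u) - 1))) ≤ exp (K * max (1 - l + ε) 0) := by
      apply exp_le_exp.2
      have h4 : 1 - y (u - σd i u) ≤ max (1 - l + ε) 0 := by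
        refine le_trans ?_ (le_max_left _ _); linarith
      have h5 := le_max_right (1 - l + ε) 0
      calc -(b i u * (y (u - σd i u) - 1)) = b i u * (1 - y (u - σd i u)) := by ring
        _ ≤ b i u * max (1 - l + ε) 0 := by
          apply mul_le_mul_of_nonneg_left h4; linarith
        _ ≤ _ := by gcongr; exact hbi.2
    exact mul_le_mul h1.le h3 (exp_pos _).le (by linarith))
  have hEt := h.Epos t ht0
  have hEs := h.Es t (by linarith) j
  have e1 : exp (-s) * exp s = 1 := by rw [← exp_add]; simp
  have hE2 : exp (-s) * E t ≤ E (t - σd j t) := by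
    calc exp (-s) * E t ≤ exp (-s) * (exp s * E (t - σd j t)) := by gcongr
      _ = _ := by rw [← mul_assoc, e1, one_mul]
  have f1 : (y (t - σd j t) - Q ε) * E (t - σd j t) ≤ (1 + η ε - Q ε) * E (t - σd j t) := by
    have := h.Epos (t - σd j t) hσ0.le
    gcongr
    linarith
  have f2 : (1 + η ε - Q ε) * E (t - σd j t) ≤ (1 + η ε - Q ε) * (exp (-s) * E t) :=
    mul_le_mul_of_nonpos_left hE2 (by linarith)
  have f3 : (y t - Q ε) * E t ≤ ((1 + η ε - Q ε) * exp (-s)) * E t := by linarith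
  have f4 := le_of_mul_le_mul_right f3 hEt
  linarith

lemma ineq2 (h : YSys m c b τd σd y E τ K s c0 c1 b0) {L l : ℝ} (hlp : 0 < l)
    (hL1 : ∀ ε > 0, ∀ᶠ t in atTop, y t < L + ε) (hl2 : ∀ ε > 0, ∃ᶠ t in atTop, y t < l + ε)
    (hl1 : ∀ ε > 0, ∀ᶠ t in atTop, l - ε < y t) (hl : l < 1) :
    l * exp (-(K * max (L - 1) 0)) + (1 - l * exp (-(K * max (L - 1) 0))) * exp (-s) ≤ l := by
  set Q : ℝ → ℝ := fun ε => (l - ε) * exp (-(K * max (L - 1 + ε) 0)) with hQ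
  set η : ℝ → ℝ := fun ε => (2 * ε + ε / c0) / (b0 * (l - ε)) with hη
  have hc0 := h.hc0
  have hb0 := h.hb0
  have hτ := h.hτ
  have hKp := h.K_pos
  have hQt : Tendsto Q (nhdsWithin 0 (Ioi 0)) (nhds (l * exp (-(K * max (L - 1) 0)))) := by
    have : ContinuousAt Q 0 := by fun_prop
    have h2 := this.tendsto.mono_left (nhdsWithin_le_nhds (s := Ioi 0))
    simpa [hQ] using h2
  have hηt : Tendsto η (nhdsWithin 0 (Ioi 0)) (nhds 0) := by
    have : ContinuousAt η 0 := by
      apply ContinuousAt.div (by fun_prop) (by fun_prop)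
      simp; exact ⟨hb0.ne', by linarith⟩
    have h2 := this.tendsto.mono_left (nhdsWithin_le_nhds (s := Ioi 0))
    simpa [hη] using h2
  have hQ0 : l * exp (-(K * max (L - 1) 0)) < 1 := by
    have : exp (-(K * max (L - 1) 0)) ≤ 1 := by
      rw [exp_le_one_iff]
      have : 0 ≤ K * max (L - 1) 0 := by positivity
      linarith
    nlinarith
  have ev1 : ∀ᶠ ε in nhdsWithin (0:ℝ) (Ioi 0), Q ε < 1 - η ε := by
    have : Tendsto (fun ε => 1 - η ε) (nhdsWithin 0 (Ioi 0)) (nhds (1 - 0)) := hηt.const_sub 1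
    exact hQt.eventually_lt this (by simpa using hQ0)
  have ev2 : ∀ᶠ ε in nhdsWithin (0:ℝ) (Ioi 0), 0 < l - ε := by
    have : ContinuousAt (fun ε => l - ε) 0 := by fun_prop
    have h2 := this.tendsto.mono_left (nhdsWithin_le_nhds (s := Ioi 0))
    exact h2.eventually (lt_mem_nhds (by simp; linarith))
  have hlim1 : Tendsto (fun ε : ℝ => l + ε) (nhdsWithin 0 (Ioi 0)) (nhds l) := by
    have : ContinuousAt (fun ε : ℝ => l + ε) 0 := by fun_prop
    have h2 := this.tendsto.mono_left (nhdsWithin_le_nhds (s := Ioi 0))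
    simpa using h2
  have hlim2 : Tendsto (fun ε : ℝ => Q ε + (1 - η ε - Q ε) * exp (-s)) (nhdsWithin 0 (Ioi 0))
      (nhds (l * exp (-(K * max (L - 1) 0)) +
        (1 - 0 - l * exp (-(K * max (L - 1) 0))) * exp (-s))) :=
    hQt.add (((hηt.const_sub 1).sub hQt).mul_const _)
  rw [sub_zero] at hlim2
  refine le_of_tendsto_of_tendsto hlim2 hlim1 ?_
  filter_upwards [ev1, ev2, self_mem_nhdsWithin] with ε he1 he2 (hε : 0 < ε)
  obtain ⟨T, hT⟩ := eventually_atTop.1 ((hL1 ε hε).and (hl1 ε hε))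
  set T' := max T 0 + 2 * τ + 1 with hT'
  have hT0 := le_max_right T 0
  have hTT := le_max_left T 0
  obtain ⟨t, htT, hyt, hdt⟩ := fluct (f := fun u => - y u) (κ := -(l + ε)) (T := T') hε
    (fun u hu => (h.der u (by linarith)).neg)
    ((hl2 ε hε).mono (fun t ht => by simpa using ht))
  have ht0 : 0 ≤ t := by linarith
  obtain ⟨j, hj⟩ : ∃ j, c j t * (y (t - τd j t) *
      exp (-(b j t * (y (t - σd j t) - 1))) - y t) ≤ ε := by
    have hne : (Finset.univ : Finset (Fin m)).Nonempty := ⟨⟨0, h.hm⟩, Finset.mem_univ _⟩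
    by_contra! hneg
    have h1 := Finset.sum_lt_sum_of_nonempty hne (fun i _ => hneg i)
    simp only [Finset.sum_const, Finset.card_univ, Fintype.card_fin, nsmul_eq_mul] at h1
    have h2 : (1:ℝ) ≤ m := by exact_mod_cast h.hm
    nlinarith
  have hdj := h.hd j t ht0
  have hbj := h.hb j t ht0
  have hcj := h.hc j t ht0
  have hj2 : y (t - τd j t) * exp (-(b j t * (y (t - σd j t) - 1))) ≤ y t + ε / c0 := by
    by_contra! hlt
    have h1 : ε / c0 * c0 = ε := by field_simp
    have h2 : ε / c0 < y (t - τd j t) * exp (-(b j t * (y (t - σd j t) - 1))) - y t := by linarith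
    have h3 : 0 < ε / c0 := by positivity
    nlinarith
  have hyτ : l - ε ≤ y (t - τd j t) := (hT _ (by linarith)).2.le
  have hw : -η ε ≤ y (t - σd j t) - 1 := by
    have hη0 : 0 ≤ η ε := by
      rw [hη]; positivity
    by_contra! hgt
    set w := y (t - σd j t) - 1 with hw
    have hwp : w < 0 := by linarith
    have e2 : 1 + b0 * (-w) ≤ exp (-(b j t * w)) := by
      have := add_one_le_exp (-(b j t * w))
      nlinarith
    have e5 : (l - ε) * (1 + b0 * (-w)) ≤ l + ε + ε / c0 := by
      calc (l - ε) * (1 + b0 * (-w)) ≤ (l - ε) * exp (-(b j t * w)) := by gcongr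
        _ ≤ y (t - τd j t) * exp (-(b j t * w)) := by gcongr
        _ ≤ _ := by linarith
    have e7 : -w ≤ η ε := by
      rw [hη]
      simp only
      rw [le_div_iff₀ (by positivity)]
      linarith
    linarith
  have hσ0 : 0 < t - σd j t := by linarith
  have hcmp := h.comp_lo (Q := Q ε) (t0 := t - σd j t) (t := t) hσ0 (by linarith) (by
    intro u hu i
    have hu0 : 0 ≤ u := by linarith [hu.1]
    have hdi := h.hd i u hu0
    have hbi := h.hb i u hu0
    have hut : u ≥ t - τ := by linarith [hu.1]
    have h1 := (hT (u - τd i u) (by linarith)).2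
    have h2 := (hT (u - σd i u) (by linarith)).1
    have h3 : exp (-(K * max (L - 1 + ε) 0)) ≤ exp (-(b i u * (y (u - σd i u) - 1))) := by
      apply exp_le_exp.2
      have h4 : y (u - σd i u) - 1 ≤ max (L - 1 + ε) 0 := by
        refine le_trans ?_ (le_max_left _ _); linarith
      have h5 := le_max_right (L - 1 + ε) 0
      have : b i u * (y (u - σd i u) - 1) ≤ K * max (L - 1 + ε) 0 := by
        calc b i u * (y (u - σd i u) - 1) ≤ b i u * max (L - 1 + ε) 0 := by
              apply mul_le_mul_of_nonneg_left h4; linarith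
          _ ≤ _ := by gcongr; exact hbi.2
      linarith
    exact mul_le_mul h1.le h3 (exp_pos _).le (by linarith))
  have hEt := h.Epos t ht0
  have hEs := h.Es t (by linarith) j
  have e1 : exp (-s) * exp s = 1 := by rw [← exp_add]; simp
  have hE2 : exp (-s) * E t ≤ E (t - σd j t) := by
    calc exp (-s) * E t ≤ exp (-s) * (exp s * E (t - σd j t)) := by gcongr
      _ = _ := by rw [← mul_assoc, e1, one_mul]
  have f1 : (1 - η ε - Q ε) * E (t - σd j t) ≤ (y (t - σd j t) - Q ε) * E (t - σd j t) := by
    have := h.Epos (t - σd j t) hσ0.le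
    gcongr
    linarith
  have f2 : (1 - η ε - Q ε) * (exp (-s) * E t) ≤ (1 - η ε - Q ε) * E (t - σd j t) :=
    mul_le_mul_of_nonneg_left hE2 (by linarith)
  have f3 : ((1 - η ε - Q ε) * exp (-s)) * E t ≤ (y t - Q ε) * E t := by linarith
  have f4 := le_of_mul_le_mul_right f3 hEt
  linarith

theorem attract (h : YSys m c b τd σd y E τ K s c0 c1 b0) : Tendsto y atTop (nhds 1) := by
  obtain ⟨B, hB⟩ := h.upper
  obtain ⟨r, hr, hrb⟩ := h.lower
  have hτ := h.hτ
  have bu : IsBoundedUnder (· ≤ ·) atTop y :=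
    isBoundedUnder_of_eventually_le (a := B)
      ((eventually_ge_atTop 0).mono fun t ht => hB t (by linarith))
  have bl : IsBoundedUnder (· ≥ ·) atTop y :=
    isBoundedUnder_of_eventually_ge (a := r) ((eventually_ge_atTop 0).mono fun t ht => hrb t ht)
  have hlL : liminf y atTop ≤ limsup y atTop := liminf_le_limsup bu bl
  have hl0 : r ≤ liminf y atTop :=
    le_liminf_of_le bu.isCoboundedUnder_ge ((eventually_ge_atTop 0).mono fun t ht => hrb t ht)
  have hL1 : ∀ ε > 0, ∀ᶠ t in atTop, y t < limsup y atTop + ε := fun ε hε =>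
    eventually_lt_of_limsup_lt (by linarith) bu
  have hL2 : ∀ ε > 0, ∃ᶠ t in atTop, limsup y atTop - ε < y t := fun ε hε =>
    frequently_lt_of_lt_limsup bl.isCoboundedUnder_le (by linarith)
  have hl1 : ∀ ε > 0, ∀ᶠ t in atTop, liminf y atTop - ε < y t := fun ε hε =>
    eventually_lt_of_lt_liminf (by linarith) bl
  have hl2 : ∀ ε > 0, ∃ᶠ t in atTop, y t < liminf y atTop + ε := fun ε hε =>
    frequently_lt_of_liminf_lt bu.isCoboundedUnder_ge (by linarith)
  obtain ⟨a1, a2⟩ := algebra_aux (hr.trans_le hl0) hlL h.hs h.K_pos.le h.hK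
    (h.ineq1 hL1 hL2 hl1) (h.ineq2 (hr.trans_le hl0) hL1 hl2 hl1)
  exact tendsto_of_liminf_eq_limsup (by linarith) (by linarith) bu bl

end YSys


/-- Periodic coefficients on the whole line -/
structure PData (m : ℕ) (p a : Fin m → ℝ → ℝ) (δ A : ℝ → ℝ) (ω D γ am ap : ℝ) : Prop where
  hm : 0 < m
  hω : 0 < ω
  hp : ∀ j t, 0 < p j t
  hδ : ∀ t, 0 < δ t
  hA : ∀ t, HasDerivAt A (δ t) t
  hAper : ∀ t, A (t + ω) = A t + D
  ham : 0 < am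
  ha : ∀ j t, am ≤ a j t ∧ a j t ≤ ap
  hlo : ∀ t, exp D * δ t ≤ ∑ j, p j t
  hhi : ∀ t, ∑ j, p j t ≤ γ * δ t

/-- positive periodic solution on the whole line -/
structure PSol (m : ℕ) (p a : Fin m → ℝ → ℝ) (δ : ℝ → ℝ) (τd σd : Fin m → ℝ → ℝ) (ω : ℝ)
    (x : ℝ → ℝ) : Prop where
  pos : ∀ t, 0 < x t
  per : Function.Periodic x ω
  der : ∀ t, HasDerivAt x
    ((∑ j, p j t * x (t - τd j t) * exp (-(a j t * x (t - σd j t)))) - δ t * x t) t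

lemma per_max {f : ℝ → ℝ} {ω : ℝ} (hω : 0 < ω) (hf : Continuous f) (hp : Function.Periodic f ω) :
    ∃ t1, ∀ t, f t ≤ f t1 := by
  obtain ⟨t1, -, h1⟩ := (isCompact_Icc (a := (0:ℝ)) (b := ω)).exists_isMaxOn
    ⟨0, le_rfl, hω.le⟩ hf.continuousOn
  refine ⟨t1, fun t => ?_⟩
  obtain ⟨u, hu, hfu⟩ := hp.exists_mem_Ico₀ hω t
  rw [hfu]
  exact h1 ⟨hu.1, hu.2.le⟩

lemma per_min {f : ℝ → ℝ} {ω : ℝ} (hω : 0 < ω) (hf : Continuous f) (hp : Function.Periodic f ω) :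
    ∃ t1, ∀ t, f t1 ≤ f t := by
  obtain ⟨t1, h⟩ := per_max (f := fun t => - f t) hω hf.neg (fun t => by simp only [hp t])
  exact ⟨t1, fun t => by linarith [h t]⟩

namespace PSol
variable {m : ℕ} {p a τd σd : Fin m → ℝ → ℝ} {δ A x : ℝ → ℝ} {ω D γ am ap : ℝ}

lemma cont (h : PSol m p a δ τd σd ω x) : Continuous x :=
  continuous_iff_continuousAt.2 fun t => (h.der t).continuousAt

end PSol

namespace PData
variable {m : ℕ} {p a τd σd : Fin m → ℝ → ℝ} {δ A x : ℝ → ℝ} {ω D γ am ap : ℝ}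

lemma A_lt (P : PData m p a δ A ω D γ am ap) {s t : ℝ} (h : s < t) : A s < A t := by
  refine strictMono_of_deriv_pos (fun u => ?_) h
  rw [(P.hA u).deriv]; exact P.hδ u

lemma D_pos (P : PData m p a δ A ω D γ am ap) : 0 < D := by
  have := P.A_lt (s := 0) (t := 0 + ω) (by linarith [P.hω])
  rw [P.hAper] at this
  linarith

lemma am_le_ap (P : PData m p a δ A ω D γ am ap) : am ≤ ap :=
  (P.ha ⟨0, P.hm⟩ 0).1.trans (P.ha ⟨0, P.hm⟩ 0).2

lemma γ_ge (P : PData m p a δ A ω D γ am ap) : exp D ≤ γ :=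
  le_of_mul_le_mul_right ((P.hlo 0).trans (P.hhi 0)) (P.hδ 0)

lemma logγ_pos (P : PData m p a δ A ω D γ am ap) : 0 < log γ := by
  apply log_pos
  have h1 := P.γ_ge
  have h2 := one_lt_exp_iff.2 P.D_pos
  linarith

lemma nonempty (P : PData m p a δ A ω D γ am ap) : (Finset.univ : Finset (Fin m)).Nonempty :=
  ⟨⟨0, P.hm⟩, Finset.mem_univ _⟩

lemma E_der (P : PData m p a δ A ω D γ am ap) (S : PSol m p a δ τd σd ω x) (t : ℝ) :
    HasDerivAt (fun t => x t * exp (A t))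
      ((∑ j, p j t * x (t - τd j t) * exp (-(a j t * x (t - σd j t)))) * exp (A t)) t := by
  refine ((S.der t).mul (P.hA t).exp).congr_deriv ?_
  ring

lemma E_mono (P : PData m p a δ A ω D γ am ap) (S : PSol m p a δ τd σd ω x) {s t : ℝ}
    (h : s ≤ t) : x s * exp (A s) ≤ x t * exp (A t) :=
  mono_of_der (f := fun t => x t * exp (A t)) h (fun u _ => P.E_der S u) (fun u _ => by
    apply mul_nonneg _ (exp_pos _).le
    apply Finset.sum_nonneg
    intro j _
    exact mul_nonneg (mul_nonneg (P.hp j u).le (S.pos _).le) (exp_pos _).le)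

lemma osc (P : PData m p a δ A ω D γ am ap) (S : PSol m p a δ τd σd ω x) (t1 t2 : ℝ) :
    x t1 < exp D * x t2 := by
  obtain ⟨k, hk, -⟩ := existsUnique_add_zsmul_mem_Ico P.hω t2 t1
  have h1 := P.E_mono S hk.1
  have h2 : x (t2 + k • ω) = x t2 := S.per.zsmul k t2
  rw [h2] at h1
  have h3 : A (t2 + k • ω) < A t1 + D := by rw [← P.hAper]; exact P.A_lt hk.2
  have h4 : exp (A (t2 + k • ω)) < exp (A t1) * exp D := by
    rw [← exp_add]; exact exp_lt_exp.2 h3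
  have h5 := S.pos t2
  have h6 := exp_pos (A t1)
  have h7 : x t1 * exp (A t1) < (exp D * x t2) * exp (A t1) := by nlinarith
  exact lt_of_mul_lt_mul_right h7 h6.le

lemma ex_le (P : PData m p a δ A ω D γ am ap) (S : PSol m p a δ τd σd ω x) :
    ∃ t, x t ≤ log γ / am := by
  by_contra! hcon
  obtain ⟨t1, h1⟩ := per_max P.hω S.cont S.per
  have hd := IsLocalMax.hasDerivAt_eq_zero (Eventually.of_forall h1) (S.der t1)
  have hγ : 0 < γ := (exp_pos D).trans_le P.γ_ge
  have h2 : ∑ j, p j t1 * x (t1 - τd j t1) * exp (-(a j t1 * x (t1 - σd j t1))) <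
      ∑ j, p j t1 * (x t1 * γ⁻¹) := by
    apply Finset.sum_lt_sum_of_nonempty P.nonempty
    intro j _
    rw [mul_assoc]
    apply mul_lt_mul_of_pos_left _ (P.hp j t1)
    have h3 : exp (-(a j t1 * x (t1 - σd j t1))) < γ⁻¹ := by
      rw [← exp_log (inv_pos.2 hγ), log_inv]
      apply exp_lt_exp.2
      have h4 := hcon (t1 - σd j t1)
      rw [div_lt_iff₀ P.ham] at h4
      have h5 := (P.ha j t1).1
      nlinarith [S.pos (t1 - σd j t1)]
    have h6 := h1 (t1 - τd j t1)
    have h7 := S.pos (t1 - τd j t1)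
    have h8 := S.pos t1
    exact mul_lt_mul' h6 h3 (exp_pos _).le h8
  rw [← Finset.sum_mul] at h2
  have h9 := mul_le_mul_of_nonneg_right (P.hhi t1)
    (show 0 ≤ x t1 * γ⁻¹ by have := S.pos t1; positivity)
  have h10 : γ * δ t1 * (x t1 * γ⁻¹) = δ t1 * x t1 := by field_simp
  linarith

lemma ex_ge (P : PData m p a δ A ω D γ am ap) (S : PSol m p a δ τd σd ω x) :
    ∃ t, D / ap ≤ x t := by
  by_contra! hcon
  obtain ⟨t1, h1⟩ := per_min P.hω S.cont S.per
  have hd := IsLocalMin.hasDerivAt_eq_zero (Eventually.of_forall h1) (S.der t1)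
  have hap : 0 < ap := P.ham.trans_le P.am_le_ap
  have h2 : ∑ j, p j t1 * (x t1 * exp (-D)) <
      ∑ j, p j t1 * x (t1 - τd j t1) * exp (-(a j t1 * x (t1 - σd j t1))) := by
    apply Finset.sum_lt_sum_of_nonempty P.nonempty
    intro j _
    rw [mul_assoc]
    apply mul_lt_mul_of_pos_left _ (P.hp j t1)
    have h3 : exp (-D) < exp (-(a j t1 * x (t1 - σd j t1))) := by
      apply exp_lt_exp.2
      have h4 := hcon (t1 - σd j t1)
      rw [lt_div_iff₀ hap] at h4
      have h5 := (P.ha j t1).2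
      nlinarith [S.pos (t1 - σd j t1)]
    exact mul_lt_mul' (h1 _) h3 (exp_pos _).le (S.pos _)
  rw [← Finset.sum_mul] at h2
  have h9 := mul_le_mul_of_nonneg_right (P.hlo t1)
    (show 0 ≤ x t1 * exp (-D) by have := S.pos t1; positivity)
  have h11 : exp D * exp (-D) = 1 := by rw [← exp_add]; simp
  have h10 : exp D * δ t1 * (x t1 * exp (-D)) = δ t1 * x t1 := by
    linear_combination (δ t1 * x t1) * h11
  linarith

lemma hi (P : PData m p a δ A ω D γ am ap) (S : PSol m p a δ τd σd ω x) (t : ℝ) :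
    x t < exp D * (log γ / am) := by
  obtain ⟨t2, h2⟩ := P.ex_le S
  have := P.osc S t t2
  have h3 := mul_le_mul_of_nonneg_left h2 (exp_pos D).le
  linarith

lemma lo (P : PData m p a δ A ω D γ am ap) (S : PSol m p a δ τd σd ω x) (t : ℝ) :
    exp (-D) * (D / ap) ≤ x t := by
  obtain ⟨t2, h2⟩ := P.ex_ge S
  have h1 := P.osc S t2 t
  have h11 : exp (-D) * exp D = 1 := by rw [← exp_add]; simp
  calc exp (-D) * (D / ap) ≤ exp (-D) * (exp D * x t) := by gcongr; linarith
    _ = x t := by rw [← mul_assoc, h11, one_mul]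

/-- first half of the linear estimate: the minimum of a solution is nonpositive -/
lemma lin_half1 {c b τd σd : Fin m → ℝ → ℝ} {y : ℝ → ℝ} (hm : 0 < m)
    (hc : ∀ j t, 0 < c j t) (hb : ∀ j t, 0 < b j t)
    (hy : ∀ t, HasDerivAt y (∑ j, c j t * (y (t - τd j t) - b j t * y (t - σd j t) - y t)) t)
    {t1 : ℝ} (h1 : ∀ t, y t ≤ y t1) : ∃ j, y (t1 - σd j t1) ≤ 0 := by
  have hd := IsLocalMax.hasDerivAt_eq_zero (Eventually.of_forall h1) (hy t1)
  by_contra! hcon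
  have : ∑ j, c j t1 * (y (t1 - τd j t1) - b j t1 * y (t1 - σd j t1) - y t1) < 0 := by
    apply Finset.sum_neg
    · intro j _
      apply mul_neg_of_pos_of_neg (hc j t1)
      have := mul_pos (hb j t1) (hcon j)
      linarith [h1 (t1 - τd j t1)]
    · exact ⟨⟨0, hm⟩, Finset.mem_univ _⟩
  linarith

lemma lin_half2 {c b τd σd : Fin m → ℝ → ℝ} {y E : ℝ → ℝ} {K' : ℝ} (hm : 0 < m) (hω : 0 < ω)
    (hc : ∀ j t, 0 < c j t) (hb : ∀ j t, 0 < b j t ∧ b j t ≤ K')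
    (hE0 : ∀ t, 0 < E t) (hE : ∀ t, HasDerivAt E ((∑ j, c j t) * E t) t)
    (hEp : ∀ t, E (t + ω) = exp D * E t) (hyp : Function.Periodic y ω)
    (hy : ∀ t, HasDerivAt y (∑ j, c j t * (y (t - τd j t) - b j t * y (t - σd j t) - y t)) t)
    {t1 Y : ℝ} (h1 : ∀ t, y t ≤ y t1) (h2 : ∀ t, -Y ≤ y t) (hX : 0 ≤ y t1) (hY : 0 ≤ Y) :
    y t1 ≤ K' * Y * (exp D - 1) := by
  obtain ⟨j, hj⟩ := lin_half1 hm hc (fun j t => (hb j t).1) hy h1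
  obtain ⟨k, hk, -⟩ := existsUnique_add_zsmul_mem_Ioc hω (t1 - σd j t1) (t1 - ω)
  rw [sub_add_cancel] at hk
  set t0 := t1 - σd j t1 + k • ω with ht0
  have hy0 : y t0 ≤ 0 := by rw [ht0, hyp.zsmul k]; exact hj
  have hK' : 0 ≤ K' := (hb ⟨0, hm⟩ 0).1.le.trans (hb ⟨0, hm⟩ 0).2
  set Q := y t1 + K' * Y with hQ
  have key := anti_of_der (f := fun u => (y u - Q) * E u) hk.2
    (fun u _ => ((hy u).sub_const Q).mul (hE u))
    (fun u _ => by
      have : (∑ j, c j u * (y (u - τd j u) - b j u * y (u - σd j u) - y u)) * E u +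
          (y u - Q) * ((∑ j, c j u) * E u) =
          (∑ j, c j u * (y (u - τd j u) - b j u * y (u - σd j u) - Q)) * E u := by
        simp only [mul_sub, Finset.sum_sub_distrib, ← Finset.sum_mul]
        ring
      rw [this]
      apply mul_nonpos_of_nonpos_of_nonneg _ (hE0 u).le
      apply Finset.sum_nonpos
      intro i _
      apply mul_nonpos_of_nonneg_of_nonpos (hc i u).le
      have e1 := h1 (u - τd i u)
      have e2 := h2 (u - σd i u)
      have e3 := hb i u
      have e4 : -(b i u * y (u - σd i u)) ≤ b i u * Y := by nlinarith
      have e5 : b i u * Y ≤ K' * Y := by gcongr; exact e3.2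
      linarith)
  have hEm : E t1 ≤ exp D * E t0 := by
    rw [← hEp]
    apply mono_of_der (by linarith [hk.1]) (fun u _ => hE u)
    intro u _
    exact mul_nonneg (Finset.sum_nonneg fun i _ => (hc i u).le) (hE0 u).le
  have hQ0 : 0 ≤ Q := by positivity
  have e6 : Q * E t0 ≤ K' * Y * E t1 := by
    have : y t0 * E t0 ≤ 0 := mul_nonpos_of_nonpos_of_nonneg hy0 (hE0 t0).le
    have e8 : (y t1 - Q) = -(K' * Y) := by rw [hQ]; ring
    rw [e8] at key
    linarith
  have e7 : Q * E t0 ≤ (K' * Y * exp D) * E t0 := by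
    have := mul_le_mul_of_nonneg_left hEm (show 0 ≤ K' * Y by positivity)
    linarith
  have e9 := le_of_mul_le_mul_right e7 (hE0 t0)
  linarith

/-- the linearised equation has no nontrivial periodic solution -/
lemma lin_inj (P : PData m p a δ A ω D γ am ap) (S : PSol m p a δ τd σd ω x)
    (hK : ap / am * exp D * log γ * (exp D - 1) ≤ 1) {z : ℝ → ℝ} (hzp : Function.Periodic z ω)
    (hz : ∀ t, HasDerivAt z ((∑ j, p j t * exp (-(a j t * x (t - σd j t))) *
      (z (t - τd j t) - a j t * x (t - τd j t) * z (t - σd j t))) - δ t * z t) t) :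
    ∀ t, z t = 0 := by
  set c : Fin m → ℝ → ℝ := fun j t =>
    p j t * x (t - τd j t) * exp (-(a j t * x (t - σd j t))) / x t with hc
  set b : Fin m → ℝ → ℝ := fun j t => a j t * x (t - σd j t) with hb
  set y : ℝ → ℝ := fun t => z t / x t with hy
  set E : ℝ → ℝ := fun t => x t * exp (A t) with hE
  have hap : 0 < ap := P.ham.trans_le P.am_le_ap
  obtain ⟨tm, htm⟩ := per_max P.hω S.cont S.per
  set K' := ap * x tm with hK'
  have hD1 : 0 < exp D - 1 := by have := one_lt_exp_iff.2 P.D_pos; linarith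
  have hK'1 : K' * (exp D - 1) < 1 := by
    refine lt_of_lt_of_le ?_ hK
    apply mul_lt_mul_of_pos_right _ hD1
    have h1 := mul_lt_mul_of_pos_left (P.hi S tm) hap
    have : ap * (exp D * (log γ / am)) = ap / am * exp D * log γ := by ring
    linarith
  have hcp : ∀ j t, 0 < c j t := fun j t =>
    div_pos (mul_pos (mul_pos (P.hp j t) (S.pos _)) (exp_pos _)) (S.pos _)
  have hbp : ∀ j t, 0 < b j t ∧ b j t ≤ K' := fun j t =>
    ⟨mul_pos (P.ham.trans_le (P.ha j t).1) (S.pos _),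
      mul_le_mul (P.ha j t).2 (htm _) (S.pos _).le hap.le⟩
  have hE0 : ∀ t, 0 < E t := fun t => mul_pos (S.pos t) (exp_pos _)
  have hEd : ∀ t, HasDerivAt E ((∑ j, c j t) * E t) t := fun t => by
    refine (P.E_der S t).congr_deriv ?_
    simp only [hc, hE, ← Finset.sum_div]
    have := (S.pos t).ne'
    field_simp
  have hEp : ∀ t, E (t + ω) = exp D * E t := fun t => by
    simp only [hE]
    rw [S.per t, P.hAper, exp_add]; ring
  have hyp : Function.Periodic y ω := fun t => by simp only [hy]; rw [hzp t, S.per t]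
  have hyd : ∀ t, HasDerivAt y
      (∑ j, c j t * (y (t - τd j t) - b j t * y (t - σd j t) - y t)) t := fun t => by
    have hx0 := (S.pos t).ne'
    refine ((hz t).div (S.der t) hx0).congr_deriv ?_
    have h1 : ∀ j, c j t * (y (t - τd j t) - b j t * y (t - σd j t) - y t) =
        (p j t * exp (-(a j t * x (t - σd j t))) *
          (z (t - τd j t) - a j t * x (t - τd j t) * z (t - σd j t)) * x t -
          z t * (p j t * x (t - τd j t) * exp (-(a j t * x (t - σd j t))))) / x t ^ 2 := by
      intro j
      have h2 := (S.pos (t - τd j t)).ne'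
      have h3 := (S.pos (t - σd j t)).ne'
      simp only [hc, hb, hy]
      field_simp
    simp only [h1]
    rw [← Finset.sum_div, Finset.sum_sub_distrib, ← Finset.sum_mul, ← Finset.mul_sum]
    congr 1
    ring
  have hyn : ∀ t, HasDerivAt (fun t => - y t)
      (∑ j, c j t * (-y (t - τd j t) - b j t * -y (t - σd j t) - -y t)) t := fun t => by
    refine (hyd t).neg.congr_deriv ?_
    rw [← Finset.sum_neg_distrib]
    apply Finset.sum_congr rfl
    intro j _
    ring
  have hyc : Continuous y := continuous_iff_continuousAt.2 fun t => (hyd t).continuousAt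
  obtain ⟨t1, h1⟩ := per_max P.hω hyc hyp
  obtain ⟨t2, h2⟩ := per_min P.hω hyc hyp
  have hY : 0 ≤ - y t2 := by
    obtain ⟨j, hj⟩ := lin_half1 P.hm hcp (fun j t => (hbp j t).1) hyd h1
    linarith [h2 (t1 - σd j t1)]
  have hX : 0 ≤ y t1 := by
    obtain ⟨j, hj⟩ := lin_half1 (y := fun t => - y t) P.hm hcp (fun j t => (hbp j t).1) hyn
      (t1 := t2) (fun t => by linarith [h2 t])
    linarith [h1 (t2 - σd j t2)]
  have k1 := lin_half2 P.hm P.hω hcp hbp hE0 hEd hEp hyp hyd (Y := -y t2) h1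
    (fun t => by linarith [h2 t]) hX hY
  have k2 := lin_half2 (y := fun t => - y t) P.hm P.hω hcp hbp hE0 hEd hEp
    (fun t => by simp only [hyp t]) hyn (t1 := t2) (Y := y t1) (fun t => by linarith [h2 t])
    (fun t => by linarith [h1 t]) hY hX
  have hK'0 : 0 < K' := mul_pos hap (S.pos _)
  have hz1 : y t1 = 0 ∧ y t2 = 0 := by
    set r := K' * (exp D - 1) with hr
    have hr0 : 0 < r := mul_pos hK'0 hD1
    have k1' : y t1 ≤ r * (-y t2) := by rw [hr]; linarith
    have k2' : -y t2 ≤ r * y t1 := by rw [hr]; linarith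
    constructor <;> nlinarith
  intro t
  have h3 := h1 t
  have h4 := h2 t
  have h5 : z t / x t = 0 := by
    have : y t = 0 := by linarith [hz1.1, hz1.2]
    exact this
  rcases div_eq_zero_iff.1 h5 with h | h
  · exact h
  · exact absurd h (S.pos t).ne'

end PData


theorem continuation_principle {X : Type*} [NormedAddCommGroup X] [NormedSpace ℝ X] [CompleteSpace X]
    (L : X →L[ℝ] X) (hL : IsCompactOperator L) (N : ℝ × X → X) (hN : ContDiff ℝ 1 N)
    (U B : Set X) (hU : IsOpen U) (hB : IsClosed B) (hBU : B ⊆ U)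
    (hbd : ∃ M, ∀ l ∈ Icc (0:ℝ) 1, ∀ x ∈ B, ‖N (l, x)‖ ≤ M)
    (hap : ∀ l ∈ Icc (0:ℝ) 1, ∀ x ∈ U, x = L (N (l, x)) → x ∈ B)
    (hinj : ∀ l ∈ Icc (0:ℝ) 1, ∀ x ∈ U, x = L (N (l, x)) →
      ∀ z, z = L (fderiv ℝ N (l, x) (0, z)) → z = 0)
    (h0 : ∃ x ∈ U, x = L (N (0, x))) : ∃ x ∈ U, x = L (N (1, x)) := by
  set S : Set ℝ := {l | ∃ x ∈ U, x = L (N (l, x))} with hS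
  have hcl : IsClosed (S ∩ Icc 0 1) := by
    obtain ⟨M, hM⟩ := hbd
    obtain ⟨Kc, hKc, hsub⟩ := hL.image_closedBall_subset_compact (f := (L : X →ₗ[ℝ] X)) M
    have hZ : IsClosed {q : ℝ × X | (q.1 ∈ Icc (0:ℝ) 1 ∧ q.2 ∈ B) ∧ q.2 = L (N q)} := by
      refine IsClosed.inter ?_ ?_
      · exact (isClosed_Icc.preimage continuous_fst).inter (hB.preimage continuous_snd)
      · exact isClosed_eq continuous_snd (L.continuous.comp hN.continuous)
    have hZc : IsCompact {q : ℝ × X | (q.1 ∈ Icc (0:ℝ) 1 ∧ q.2 ∈ B) ∧ q.2 = L (N q)} := by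
      refine ((isCompact_Icc (a := (0:ℝ)) (b := 1)).prod hKc).of_isClosed_subset hZ ?_
      rintro ⟨l, x⟩ ⟨⟨h1, h2⟩, h3⟩
      refine ⟨h1, ?_⟩
      simp only at h1 h2 h3 ⊢
      rw [h3]
      apply hsub
      exact ⟨N (l, x), by simpa using hM l h1 x h2, rfl⟩
    convert (hZc.image continuous_fst).isClosed using 1
    ext l
    constructor
    · rintro ⟨⟨x, hx, he⟩, hl⟩
      exact ⟨(l, x), ⟨⟨hl, hap l hl x hx he⟩, he⟩, rfl⟩
    · rintro ⟨⟨l', x⟩, ⟨⟨hl, hx⟩, he⟩, rfl⟩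
      exact ⟨⟨x, hBU hx, he⟩, hl⟩
  have := hcl.Icc_subset_of_forall_mem_nhdsWithin h0 ?_
  · exact this (right_mem_Icc.2 zero_le_one)
  rintro l ⟨⟨x, hx, he⟩, hl⟩
  have hl' : l ∈ Icc (0:ℝ) 1 := ⟨hl.1, hl.2.le⟩
  apply mem_nhdsWithin_of_mem_nhds
  set N' := fderiv ℝ N (l, x) with hN'
  have hNs : HasStrictFDerivAt N N' (l, x) :=
    hN.contDiffAt.hasStrictFDerivAt (by norm_num)
  have hΨ : HasStrictFDerivAt (fun q : ℝ × X => (q.1, q.2 - L (N q)))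
      ((ContinuousLinearMap.fst ℝ ℝ X).prod
        (ContinuousLinearMap.snd ℝ ℝ X - L.comp N')) (l, x) := by
    refine HasStrictFDerivAt.prodMk hasStrictFDerivAt_fst
      (HasStrictFDerivAt.sub hasStrictFDerivAt_snd ?_)
    exact L.hasStrictFDerivAt.comp (l, x) hNs
  set T : X →L[ℝ] X := L.comp (N'.comp (ContinuousLinearMap.inr ℝ ℝ X)) with hT
  have hTc : IsCompactOperator T := hL.comp_clm _
  have hsurj : Function.Surjective (fun z => z - T z) := by
    rcases hTc.hasEigenvalue_or_mem_resolventSet (one_ne_zero (α := ℝ)) with h | h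
    · obtain ⟨z, hz⟩ := h.exists_hasEigenvector
      exfalso
      apply hz.2
      apply hinj l hl' x hx he
      have := hz.apply_eq_smul
      simp only [one_smul] at this
      exact this.symm
    · rw [spectrum.mem_resolventSet_iff, ContinuousLinearMap.isUnit_iff_bijective] at h
      convert h.2 using 1
      ext z
      simp
  have hmap := hΨ.map_nhds_eq_of_surj (by
    rw [LinearMap.range_eq_top]
    rintro ⟨μ, w⟩
    obtain ⟨z, hz⟩ := hsurj (w + L (N' (μ, 0)))
    refine ⟨(μ, z), ?_⟩
    have e : N' (μ, z) = N' (0, z) + N' (μ, 0) := by rw [← map_add]; simp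
    have e2 : T z = L (N' (0, z)) := by simp [hT]
    simp only [e2] at hz
    have : z - L (N' (μ, z)) = w := by rw [e, map_add, ← sub_sub, hz]; simp
    simp [this])
  have hmem : (fun q : ℝ × X => (q.1, q.2 - L (N q))) '' (univ ×ˢ U) ∈ nhds (l, (0:X)) := by
    have e : (l, (0:X)) = (fun q : ℝ × X => (q.1, q.2 - L (N q))) (l, x) := by
      simp only [← he, sub_self]
    rw [e, ← hmap]
    exact image_mem_map (prod_mem_nhds univ_mem (hU.mem_nhds hx))
  have hcont : Tendsto (fun l' : ℝ => (l', (0:X))) (nhds l) (nhds (l, (0:X))) :=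
    (Continuous.prodMk continuous_id continuous_const).tendsto l
  filter_upwards [hcont hmem] with l' hl'
  obtain ⟨⟨l2, x2⟩, ⟨-, hx2⟩, h2⟩ := hl'
  simp only [Prod.mk.injEq] at h2
  obtain ⟨rfl, h2⟩ := h2
  exact ⟨x2, hx2, sub_eq_zero.1 h2⟩


/-- lift of a continuous periodic function to the circle -/
def toC {ω : ℝ} (f : ℝ → ℝ) (hc : Continuous f) (hp : Function.Periodic f ω) :
    C(AddCircle ω, ℝ) :=
  ⟨hp.lift, (QuotientAddGroup.isQuotientMap_mk _).continuous_iff.2 hc⟩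

lemma toC_apply {ω : ℝ} (f : ℝ → ℝ) (hc : Continuous f) (hp : Function.Periodic f ω) (t : ℝ) :
    toC f hc hp (t : AddCircle ω) = f t := rfl

lemma circle_per {ω : ℝ} (f : C(AddCircle ω, ℝ)) :
    Function.Periodic (fun t : ℝ => f (t : AddCircle ω)) ω := fun t => by
  simp only [AddCircle.coe_add_period]

lemma circle_cont {ω : ℝ} (f : C(AddCircle ω, ℝ)) :
    Continuous (fun t : ℝ => f (t : AddCircle ω)) :=
  f.continuous.comp (AddCircle.continuous_mk' ω)

lemma circle_ext {ω : ℝ} {f g : C(AddCircle ω, ℝ)}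
    (h : ∀ t : ℝ, f (t : AddCircle ω) = g (t : AddCircle ω)) : f = g := by
  ext x
  obtain ⟨t, rfl⟩ := QuotientAddGroup.mk_surjective x
  exact h t

lemma circle_compact {ω : ℝ} (M C : ℝ) :
    IsCompact {f : C(AddCircle ω, ℝ) | (∀ x, f x ∈ Icc (-M) M) ∧
      ∀ s t : ℝ, |f (s : AddCircle ω) - f (t : AddCircle ω)| ≤ C * |s - t|} := by
  apply ArzelaAscoli.isCompact_of_equicontinuous
  · have h1 : IsCompact (Set.pi univ (fun _ : AddCircle ω => Icc (-M) M)) :=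
      isCompact_univ_pi fun _ => isCompact_Icc
    have h2 : IsClosed {g : AddCircle ω → ℝ |
        ∀ s t : ℝ, |g (s : AddCircle ω) - g (t : AddCircle ω)| ≤ C * |s - t|} := by
      simp only [ofPred_forall]
      refine isClosed_iInter fun s => isClosed_iInter fun t => isClosed_le ?_ continuous_const
      fun_prop
    convert h1.inter_right h2 using 1
    ext g
    constructor
    · rintro ⟨f, hf, rfl⟩
      exact ⟨fun x _ => hf.1 x, hf.2⟩
    · rintro ⟨hg1, hg2⟩
      refine ⟨⟨g, (QuotientAddGroup.isQuotientMap_mk _).continuous_iff.2 ?_⟩,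
        ⟨fun x => hg1 x trivial, hg2⟩, rfl⟩
      have : LipschitzWith C.toNNReal (g ∘ (QuotientAddGroup.mk : ℝ → AddCircle ω)) := by
        apply LipschitzWith.of_dist_le_mul
        intro s t
        rw [Real.dist_eq, Real.dist_eq]
        refine (hg2 s t).trans ?_
        gcongr
        exact Real.le_coe_toNNReal C
      exact this.continuous
  · intro x
    obtain ⟨t, rfl⟩ := QuotientAddGroup.mk_surjective x
    rw [Metric.equicontinuousAt_iff_right]
    intro ε hε
    rw [QuotientAddGroup.nhds_eq, eventually_map]
    have : ∀ᶠ s in nhds t, C * |t - s| < ε := by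
      have : Continuous fun s : ℝ => C * |t - s| := by fun_prop
      exact this.continuousAt.eventually_lt continuousAt_const (by simpa using hε)
    filter_upwards [this] with s hs f
    rw [Real.dist_eq]
    exact (f.2.2 t s).trans_lt hs

section
variable {δ A : ℝ → ℝ} {ω D : ℝ}

lemma lin_unique (hD : 0 < D) (hA : ∀ t, HasDerivAt A (δ t) t) (hAper : ∀ t, A (t + ω) = A t + D)
    {z : ℝ → ℝ} (hz : Function.Periodic z ω) (hd : ∀ t, HasDerivAt z (-(δ t * z t)) t) :
    ∀ t, z t = 0 := by
  have h1 : ∀ t, HasDerivAt (fun t => z t * exp (A t)) 0 t := fun t => by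
    refine ((hd t).mul (hA t).exp).congr_deriv ?_
    ring
  intro t
  have h2 := is_const_of_deriv_eq_zero (f := fun t => z t * exp (A t))
    (fun t => (h1 t).differentiableAt) (fun t => (h1 t).deriv) (t + ω) t
  simp only [hz t, hAper, exp_add] at h2
  have h3 : z t * (exp (A t) * (exp D - 1)) = 0 := by linarith
  have h4 : exp D - 1 > 0 := by linarith [one_lt_exp_iff.2 hD]
  rcases mul_eq_zero.1 h3 with h | h
  · exact h
  · exact absurd h (by positivity)

/-- periodic solution operator -/
def Lf (A : ℝ → ℝ) (ω D : ℝ) (g : ℝ → ℝ) (t : ℝ) : ℝ :=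
  exp (-A t) * ((∫ s in (0:ℝ)..t, exp (A s) * g s) + (∫ s in (0:ℝ)..ω, exp (A s) * g s) / (exp D - 1))

lemma Lf_der (hA : ∀ t, HasDerivAt A (δ t) t) {g : ℝ → ℝ} (hg : Continuous g) (t : ℝ) :
    HasDerivAt (Lf A ω D g) (g t - δ t * Lf A ω D g t) t := by
  have hAc : Continuous A := continuous_iff_continuousAt.2 fun t => (hA t).continuousAt
  have hc : Continuous fun s => exp (A s) * g s := by fun_prop
  have h1 := (intervalIntegral.integral_hasDerivAt_right (hc.intervalIntegrable 0 t)
    (hc.stronglyMeasurableAtFilter _ _) hc.continuousAt)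
  have h2 := ((hA t).neg.exp).mul (h1.add_const
    ((∫ s in (0:ℝ)..ω, exp (A s) * g s) / (exp D - 1)))
  refine h2.congr_deriv ?_
  have : exp (-A t) * exp (A t) = 1 := by rw [← exp_add]; simp
  unfold Lf
  linear_combination g t * this

lemma Lf_per (hD : 0 < D) (hA : ∀ t, HasDerivAt A (δ t) t) (hAper : ∀ t, A (t + ω) = A t + D)
    {g : ℝ → ℝ} (hg : Continuous g) (hgp : Function.Periodic g ω) :
    Function.Periodic (Lf A ω D g) ω := by
  have hAc : Continuous A := continuous_iff_continuousAt.2 fun t => (hA t).continuousAt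
  have hc : Continuous fun s => exp (A s) * g s := by fun_prop
  intro t
  have h1 : (∫ s in (0:ℝ)..(t + ω), exp (A s) * g s) = (∫ s in (0:ℝ)..ω, exp (A s) * g s) +
      exp D * ∫ s in (0:ℝ)..t, exp (A s) * g s := by
    rw [← intervalIntegral.integral_add_adjacent_intervals (hc.intervalIntegrable 0 ω)
      (hc.intervalIntegrable ω (t + ω))]
    congr 1
    have := intervalIntegral.integral_comp_add_right (a := 0) (b := t)
      (fun s => exp (A s) * g s) ω
    rw [zero_add] at this
    rw [← this, ← intervalIntegral.integral_const_mul]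
    apply intervalIntegral.integral_congr
    intro s _
    simp only [hAper, hgp s, exp_add]
    ring
  unfold Lf
  rw [h1, hAper, neg_add, exp_add]
  have h4 : exp D - 1 > 0 := by linarith [one_lt_exp_iff.2 hD]
  have h5 : exp (-D) * exp D = 1 := by rw [← exp_add]; simp
  set I := ∫ s in (0:ℝ)..ω, exp (A s) * g s
  have h6 : I / (exp D - 1) * (exp D - 1) = I := by field_simp
  set c := I / (exp D - 1)
  rw [← h6]
  linear_combination exp (-A t) * ((∫ s in (0:ℝ)..t, exp (A s) * g s) + c) * h5

lemma exists_L (hω : 0 < ω) (hD : 0 < D) (hδc : Continuous δ) (hδ : ∀ t, 0 < δ t)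
    (hδp : Function.Periodic δ ω)
    (hA : ∀ t, HasDerivAt A (δ t) t) (hAper : ∀ t, A (t + ω) = A t + D) [Fact (0 < ω)] :
    ∃ L : C(AddCircle ω, ℝ) →L[ℝ] C(AddCircle ω, ℝ), IsCompactOperator L ∧
      ∀ (f : C(AddCircle ω, ℝ)) (t : ℝ), HasDerivAt (fun t : ℝ => L f (t : AddCircle ω))
        (f (t : AddCircle ω) - δ t * L f (t : AddCircle ω)) t := by
  have hAc : Continuous A := continuous_iff_continuousAt.2 fun t => (hA t).continuousAt
  have hAm : Monotone A := monotone_of_deriv_nonneg (fun t => (hA t).differentiableAt)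
    (fun t => by rw [(hA t).deriv]; exact (hδ t).le)
  have h4 : exp D - 1 > 0 := by linarith [one_lt_exp_iff.2 hD]
  have hLc : ∀ f : C(AddCircle ω, ℝ), Continuous (Lf A ω D (fun t : ℝ => f (t : AddCircle ω))) :=
    fun f => continuous_iff_continuousAt.2 fun t => (Lf_der hA (circle_cont f) t).continuousAt
  have hItg : ∀ (f : C(AddCircle ω, ℝ)) (a b : ℝ), IntervalIntegrable
      (fun s : ℝ => exp (A s) * f (s : AddCircle ω)) volume a b := fun f a b =>
    (Continuous.mul (by fun_prop) (circle_cont f)).intervalIntegrable a b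
  let L0 : C(AddCircle ω, ℝ) →ₗ[ℝ] C(AddCircle ω, ℝ) :=
    { toFun := fun f => toC _ (hLc f) (Lf_per hD hA hAper (circle_cont f) (circle_per f))
      map_add' := fun f g => by
        apply circle_ext
        intro t
        simp only [ContinuousMap.add_apply, toC_apply, Lf]
        simp only [mul_add]
        rw [intervalIntegral.integral_add (hItg f _ _) (hItg g _ _),
          intervalIntegral.integral_add (hItg f _ _) (hItg g _ _)]
        ring
      map_smul' := fun c f => by
        apply circle_ext
        intro t
        simp only [ContinuousMap.smul_apply, toC_apply, Lf, smul_eq_mul, RingHom.id_apply]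
        simp only [mul_left_comm _ c, intervalIntegral.integral_const_mul]
        ring }
  set M := exp (-A 0) * (exp (A ω) * ω + exp (A ω) * ω / (exp D - 1)) with hM
  have hM0 : 0 ≤ M := by positivity
  have hb : ∀ f (t : ℝ), |L0 f (t : AddCircle ω)| ≤ M * ‖f‖ := by
    intro f t
    obtain ⟨u, hu, hfu⟩ := (circle_per (L0 f)).exists_mem_Ico₀ hω t
    rw [hfu]
    have key : ∀ v ∈ Icc 0 ω, |∫ s in (0:ℝ)..v, exp (A s) * f (s : AddCircle ω)| ≤
        exp (A ω) * ω * ‖f‖ := by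
      intro v hv
      have := intervalIntegral.norm_integral_le_of_norm_le_const (a := 0) (b := v)
        (f := fun s : ℝ => exp (A s) * f (s : AddCircle ω)) (C := exp (A ω) * ‖f‖) (by
          intro s hs
          rw [uIoc_of_le hv.1] at hs
          rw [norm_mul, Real.norm_eq_abs, abs_exp]
          gcongr
          · exact hAm (hs.2.trans hv.2)
          · exact f.norm_coe_le_norm _)
      rw [Real.norm_eq_abs] at this
      refine this.trans ?_
      rw [sub_zero, abs_of_nonneg hv.1]
      have : exp (A ω) * ‖f‖ * v ≤ exp (A ω) * ‖f‖ * ω := by gcongr; exact hv.2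
      linarith
    change |Lf A ω D (fun t : ℝ => f (t : AddCircle ω)) u| ≤ _
    unfold Lf
    rw [abs_mul, abs_exp, hM, mul_assoc]
    gcongr
    · exact hAm hu.1
    · refine (abs_add_le _ _).trans ?_
      rw [add_mul]
      gcongr
      · exact key u ⟨hu.1, hu.2.le⟩
      · rw [abs_div, abs_of_pos h4, div_mul_eq_mul_div]
        gcongr
        exact key ω ⟨hω.le, le_rfl⟩
  have hb' : ∀ f, ‖L0 f‖ ≤ M * ‖f‖ := by
    intro f
    rw [ContinuousMap.norm_le _ (by positivity)]
    intro x
    obtain ⟨t, rfl⟩ := QuotientAddGroup.mk_surjective x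
    exact hb f t
  have hd : ∀ (f : C(AddCircle ω, ℝ)) (t : ℝ), HasDerivAt (fun t : ℝ => L0 f (t : AddCircle ω))
        (f (t : AddCircle ω) - δ t * L0 f (t : AddCircle ω)) t := fun f t =>
    Lf_der hA (circle_cont f) t
  refine ⟨L0.mkContinuous M hb', ?_, hd⟩
  obtain ⟨t1, ht1⟩ := per_max hω hδc hδp
  rw [isCompactOperator_iff_exists_mem_nhds_image_subset_compact]
  refine ⟨Metric.closedBall 0 1, Metric.closedBall_mem_nhds _ one_pos, _,
    circle_compact M (1 + δ t1 * M), ?_⟩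
  rintro _ ⟨f, hf, rfl⟩
  rw [mem_closedBall_zero_iff] at hf
  have hMf : M * ‖f‖ ≤ M := by nlinarith
  refine ⟨fun x => ?_, fun s t => ?_⟩
  · obtain ⟨t, rfl⟩ := QuotientAddGroup.mk_surjective x
    exact abs_le.1 ((hb f t).trans hMf)
  · have := Convex.norm_image_sub_le_of_norm_hasDerivWithin_le
      (f := fun t : ℝ => L0 f (t : AddCircle ω)) (C := 1 + δ t1 * M) (s := univ) (x := t) (y := s)
      (fun u _ => (hd f u).hasDerivWithinAt) (by
        intro u _
        refine (norm_sub_le _ _).trans ?_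
        gcongr
        · exact (f.norm_coe_le_norm _).trans hf
        · rw [norm_mul, Real.norm_eq_abs, Real.norm_eq_abs, abs_of_pos (hδ u)]
          gcongr
          · exact (hδ t1).le
          · exact ht1 u
          · exact (hb f u).trans hMf) convex_univ trivial trivial
    exact this
end


/-- composition with a continuous map as a continuous linear map -/
def Sh {ω : ℝ} (f : C(AddCircle ω, AddCircle ω)) [Fact (0 < ω)] :
    C(AddCircle ω, ℝ) →L[ℝ] C(AddCircle ω, ℝ) :=
  ⟨(ContinuousMap.compRightAlgHom ℝ ℝ f).toLinearMap, ContinuousMap.compRightAlgHom_continuous ℝ ℝ f⟩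

lemma Sh_apply {ω : ℝ} (f : C(AddCircle ω, AddCircle ω)) [Fact (0 < ω)] (x : C(AddCircle ω, ℝ))
    (θ : AddCircle ω) : Sh f x θ = x (f θ) := rfl

/-- delay map on the circle -/
def dl {ω : ℝ} (g : C(AddCircle ω, ℝ)) : C(AddCircle ω, AddCircle ω) :=
  ⟨fun θ => θ - ((g θ : ℝ) : AddCircle ω),
    continuous_id.sub ((AddCircle.continuous_mk' ω).comp g.continuous)⟩

lemma dl_apply {ω : ℝ} (g : C(AddCircle ω, ℝ)) (t : ℝ) :
    dl g (t : AddCircle ω) = ((t - g (t : AddCircle ω) : ℝ) : AddCircle ω) := rfl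

lemma exp_eval {ω : ℝ} [Fact (0 < ω)] (f : C(AddCircle ω, ℝ)) (θ : AddCircle ω) :
    (NormedSpace.exp f) θ = Real.exp (f θ) := by
  rw [Real.exp_eq_exp_ℝ]
  exact NormedSpace.map_exp (ContinuousMap.evalAlgHom ℝ ℝ θ) (by
    exact (ContinuousMap.evalCLM ℝ θ).continuous) f

lemma exp_contDiff {ω : ℝ} [Fact (0 < ω)] :
    ContDiff ℝ 1 (NormedSpace.exp : C(AddCircle ω, ℝ) → C(AddCircle ω, ℝ)) :=
  contDiff_iff_contDiffAt.2 fun x => (NormedSpace.exp_analytic (𝕂 := ℝ) x).contDiffAt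

/-- the nonlinearity along the homotopy -/
def Nn {ω : ℝ} [Fact (0 < ω)] {m : ℕ} (G H : C(AddCircle ω, ℝ))
    (P Q T S : Fin m → C(AddCircle ω, ℝ)) (q : ℝ × C(AddCircle ω, ℝ)) : C(AddCircle ω, ℝ) :=
  ∑ j, ((1 - q.1) • G + q.1 • P j) * Sh (dl (T j)) q.2 *
    NormedSpace.exp (-(((1 - q.1) • H + q.1 • Q j) * Sh (dl (S j)) q.2))

lemma Nn_contDiff {ω : ℝ} [Fact (0 < ω)] {m : ℕ} (G H : C(AddCircle ω, ℝ))
    (P Q T S : Fin m → C(AddCircle ω, ℝ)) : ContDiff ℝ 1 (Nn G H P Q T S) := by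
  unfold Nn
  apply ContDiff.sum
  intro j _
  have h1 : ContDiff ℝ 1 fun q : ℝ × C(AddCircle ω, ℝ) => Sh (dl (T j)) q.2 :=
    (Sh (dl (T j))).contDiff.comp contDiff_snd
  have h2 : ContDiff ℝ 1 fun q : ℝ × C(AddCircle ω, ℝ) => Sh (dl (S j)) q.2 :=
    (Sh (dl (S j))).contDiff.comp contDiff_snd
  have h3 : ∀ F G : C(AddCircle ω, ℝ),
      ContDiff ℝ 1 fun q : ℝ × C(AddCircle ω, ℝ) => (1 - q.1) • F + q.1 • G := by
    intro F G; fun_prop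
  exact ((h3 _ _).mul h1).mul (exp_contDiff.comp ((h3 _ _).mul h2).neg)

lemma Nn_apply {ω : ℝ} [Fact (0 < ω)] {m : ℕ} (G H : C(AddCircle ω, ℝ))
    (P Q T S : Fin m → C(AddCircle ω, ℝ)) (l : ℝ) (x : C(AddCircle ω, ℝ)) (θ : AddCircle ω) :
    Nn G H P Q T S (l, x) θ = ∑ j, ((1 - l) * G θ + l * P j θ) * x (dl (T j) θ) *
    exp (-(((1 - l) * H θ + l * Q j θ) * x (dl (S j) θ))) := by
  unfold Nn
  rw [ContinuousMap.sum_apply]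
  refine Finset.sum_congr rfl fun j _ => ?_
  simp only [ContinuousMap.mul_apply, ContinuousMap.add_apply, ContinuousMap.smul_apply,
    smul_eq_mul, exp_eval, ContinuousMap.neg_apply, Sh_apply]

lemma Nn_fderiv {ω : ℝ} [Fact (0 < ω)] {m : ℕ} (G H : C(AddCircle ω, ℝ))
    (P Q T S : Fin m → C(AddCircle ω, ℝ)) (l : ℝ) (x z : C(AddCircle ω, ℝ)) (θ : AddCircle ω) :
    fderiv ℝ (Nn G H P Q T S) (l, x) (0, z) θ = ∑ j, ((1 - l) * G θ + l * P j θ) *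
    exp (-(((1 - l) * H θ + l * Q j θ) * x (dl (S j) θ))) *
    (z (dl (T j) θ) - ((1 - l) * H θ + l * Q j θ) * x (dl (T j) θ) * z (dl (S j) θ)) := by
  have h1 : HasFDerivAt (Nn G H P Q T S) (fderiv ℝ (Nn G H P Q T S) (l, x)) (l, x) :=
    ((Nn_contDiff G H P Q T S).differentiable (by norm_num) _).hasFDerivAt
  have h2 : HasDerivAt (fun s : ℝ => (l, x + s • z)) (0, z) 0 := by
    refine HasDerivAt.prodMk (hasDerivAt_const _ _) ?_
    have := ((hasDerivAt_id (0:ℝ)).smul_const z).const_add x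
    simpa using this
  have h3 : HasDerivAt (fun s : ℝ => Nn G H P Q T S (l, x + s • z))
      (fderiv ℝ (Nn G H P Q T S) (l, x) (0, z)) 0 := by
    refine HasFDerivAt.comp_hasDerivAt_of_eq (0:ℝ) h1 h2 ?_
    simp
  have h4 : HasDerivAt (fun s : ℝ => Nn G H P Q T S (l, x + s • z) θ)
      (fderiv ℝ (Nn G H P Q T S) (l, x) (0, z) θ) 0 :=
    (ContinuousMap.evalCLM (R := ℝ) (M := ℝ) θ).hasFDerivAt.comp_hasDerivAt (0:ℝ) h3
  refine h4.unique ?_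
  simp only [Nn_apply, ContinuousMap.add_apply, ContinuousMap.smul_apply, smul_eq_mul]
  apply HasDerivAt.fun_sum
  intro j _
  have e1 : ∀ θ, HasDerivAt (fun s : ℝ => x θ + s * z θ) (z θ) 0 := fun θ => by
    simpa using ((hasDerivAt_id (0:ℝ)).mul_const (z θ)).const_add (x θ)
  have := ((e1 (dl (T j) θ)).const_mul ((1 - l) * G θ + l * P j θ)).mul
    (((e1 (dl (S j) θ)).const_mul ((1 - l) * H θ + l * Q j θ)).neg.exp)
  refine this.congr_deriv ?_
  simp only [Pi.neg_apply, zero_mul, add_zero]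
  ring


lemma PData.homot {m : ℕ} {p a : Fin m → ℝ → ℝ} {δ A : ℝ → ℝ} {ω D γ am ap : ℝ}
    (P : PData m p a δ A ω D γ am ap) {l : ℝ} (hl : l ∈ Icc (0:ℝ) 1) :
    PData m (fun j t => (1 - l) * (γ * δ t / m) + l * p j t)
      (fun j t => (1 - l) * ap + l * a j t) δ A ω D γ am ap := by
  have hm : (0:ℝ) < m := by exact_mod_cast P.hm
  have hγ : 0 < γ := (exp_pos D).trans_le P.γ_ge
  have hs : ∀ t, ∑ j : Fin m, ((1 - l) * (γ * δ t / m) + l * p j t) =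
      (1 - l) * (γ * δ t) + l * ∑ j, p j t := by
    intro t
    rw [Finset.sum_add_distrib, Finset.sum_const, ← Finset.mul_sum, Finset.card_univ,
      Fintype.card_fin, nsmul_eq_mul]
    field_simp
  have h1 : 0 ≤ 1 - l := by linarith [hl.2]
  refine ⟨P.hm, P.hω, ?_, P.hδ, P.hA, P.hAper, P.ham, ?_, ?_, ?_⟩
  · intro j t
    have e1 : 0 < γ * δ t / m := div_pos (mul_pos hγ (P.hδ t)) hm
    have e2 := P.hp j t
    rcases eq_or_lt_of_le hl.1 with h | h
    · subst h; simpa using e1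
    · have := mul_pos h e2
      have := mul_nonneg h1 e1.le
      linarith
  · intro j t
    have := P.ha j t
    have h2 := P.am_le_ap
    constructor <;> nlinarith [hl.1]
  · intro t
    rw [hs]
    have := P.hlo t
    have h2 := mul_le_mul_of_nonneg_right P.γ_ge (P.hδ t).le
    nlinarith [hl.1]
  · intro t
    rw [hs]
    nlinarith [hl.1, P.hhi t]

theorem PData.exists_sol {m : ℕ} {p a τd σd : Fin m → ℝ → ℝ} {δ A : ℝ → ℝ} {ω D γ am ap : ℝ}
    (P : PData m p a δ A ω D γ am ap)
    (hpc : ∀ j, Continuous (p j)) (hpp : ∀ j, Function.Periodic (p j) ω)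
    (hac : ∀ j, Continuous (a j)) (happ : ∀ j, Function.Periodic (a j) ω)
    (hτc : ∀ j, Continuous (τd j)) (hτp : ∀ j, Function.Periodic (τd j) ω)
    (hσc : ∀ j, Continuous (σd j)) (hσp : ∀ j, Function.Periodic (σd j) ω)
    (hδc : Continuous δ) (hδp : Function.Periodic δ ω)
    (hK : ap / am * exp D * log γ * (exp D - 1) ≤ 1) :
    ∃ x, PSol m p a δ τd σd ω x := by
  have : Fact (0 < ω) := ⟨P.hω⟩
  have hm : (0:ℝ) < m := by exact_mod_cast P.hm
  have hγ : 0 < γ := (exp_pos D).trans_le P.γ_ge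
  have hap : 0 < ap := P.ham.trans_le P.am_le_ap
  have hD := P.D_pos
  have hlog := P.logγ_pos
  obtain ⟨L, hLc, hL⟩ := exists_L P.hω P.D_pos hδc P.hδ hδp P.hA P.hAper
  obtain ⟨t1, ht1⟩ := per_max P.hω hδc hδp
  set G : C(AddCircle ω, ℝ) := toC (fun t => γ * δ t / m) (by fun_prop)
    (fun t => by simp only [hδp t]) with hG
  set H : C(AddCircle ω, ℝ) := toC (fun _ => ap) (by fun_prop) (fun t => rfl) with hH
  set Pc := fun j => toC (p j) (hpc j) (hpp j) with hPc
  set Qc := fun j => toC (a j) (hac j) (happ j) with hQc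
  set T := fun j => toC (τd j) (hτc j) (hτp j) with hT
  set S := fun j => toC (σd j) (hσc j) (hσp j) with hS
  have hNt : ∀ (l : ℝ) (x : C(AddCircle ω, ℝ)) (t : ℝ),
      Nn G H Pc Qc T S (l, x) (t : AddCircle ω) =
      ∑ j, ((1 - l) * (γ * δ t / m) + l * p j t) * x ((t - τd j t : ℝ) : AddCircle ω) *
        exp (-(((1 - l) * ap + l * a j t) * x ((t - σd j t : ℝ) : AddCircle ω))) :=
    fun l x t => Nn_apply G H Pc Qc T S l x t
  have hNd : ∀ (l : ℝ) (x z : C(AddCircle ω, ℝ)) (t : ℝ),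
      fderiv ℝ (Nn G H Pc Qc T S) (l, x) (0, z) (t : AddCircle ω) =
      ∑ j, ((1 - l) * (γ * δ t / m) + l * p j t) *
        exp (-(((1 - l) * ap + l * a j t) * x ((t - σd j t : ℝ) : AddCircle ω))) *
        (z ((t - τd j t : ℝ) : AddCircle ω) - ((1 - l) * ap + l * a j t) *
          x ((t - τd j t : ℝ) : AddCircle ω) * z ((t - σd j t : ℝ) : AddCircle ω)) :=
    fun l x z t => Nn_fderiv G H Pc Qc T S l x z t
  set U : Set C(AddCircle ω, ℝ) := {x | ∀ θ, 0 < x θ} with hU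
  set r := exp (-D) * (D / ap) with hr
  set R := exp D * (log γ / am) with hR
  have hR0 : 0 < R := mul_pos (exp_pos _) (div_pos hlog P.ham)
  have hr0 : 0 < r := by positivity
  set B : Set C(AddCircle ω, ℝ) := {x | ∀ θ, r ≤ x θ ∧ x θ ≤ R} with hB
  have hsol : ∀ (l : ℝ) (x : C(AddCircle ω, ℝ)), x ∈ U → x = L (Nn G H Pc Qc T S (l, x)) →
      PSol m (fun j t => (1 - l) * (γ * δ t / m) + l * p j t)
      (fun j t => (1 - l) * ap + l * a j t) δ τd σd ω (fun t : ℝ => x (t : AddCircle ω)) := by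
    intro l x hx he
    refine ⟨fun t => hx _, circle_per x, fun t => ?_⟩
    have := hL (Nn G H Pc Qc T S (l, x)) t
    rw [← he, hNt] at this
    exact this
  suffices hmain : ∃ x ∈ U, x = L (Nn G H Pc Qc T S (1, x)) by
    obtain ⟨x, hx, he⟩ := hmain
    have := hsol 1 x hx he
    refine ⟨fun t : ℝ => x (t : AddCircle ω), ?_⟩
    simpa using this
  refine continuation_principle L hLc (Nn G H Pc Qc T S)
    (Nn_contDiff G H Pc Qc T S) U B ?_ ?_ ?_ ?_ ?_ ?_ ?_
  · -- U open
    have := ContinuousMap.isOpen_setOfPred_mapsTo (X := AddCircle ω) (Y := ℝ) isCompact_univ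
      (isOpen_Ioi (a := (0:ℝ)))
    have e : U = {f : C(AddCircle ω, ℝ) | MapsTo f univ (Ioi (0:ℝ))} := by
      apply Set.ext
      intro f
      exact ⟨fun h θ _ => h θ, fun h θ => h (mem_univ θ)⟩
    rw [e]
    exact this
  · -- B closed
    have : B = ⋂ θ, {x : C(AddCircle ω, ℝ) | r ≤ x θ ∧ x θ ≤ R} := by
      ext f; simp [hB]
    rw [this]
    refine isClosed_iInter fun θ => ?_
    have hev : Continuous fun x : C(AddCircle ω, ℝ) => x θ :=
      ContinuousEvalConst.continuous_eval_const θ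
    have e1 : IsClosed {x : C(AddCircle ω, ℝ) | r ≤ x θ} := isClosed_le continuous_const hev
    have e2 : IsClosed {x : C(AddCircle ω, ℝ) | x θ ≤ R} := isClosed_le hev continuous_const
    exact e1.inter e2
  · exact fun x hx θ => hr0.trans_le (hx θ).1
  · refine ⟨γ * δ t1 * R, fun l hl x hx => ?_⟩
    have PH := P.homot hl
    have := P.hδ t1
    rw [ContinuousMap.norm_le _ (by positivity)]
    intro θ
    obtain ⟨t, rfl⟩ := QuotientAddGroup.mk_surjective θ
    change ‖Nn G H Pc Qc T S (l, x) (t : AddCircle ω)‖ ≤ _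
    rw [hNt]
    have hx0 : ∀ θ, 0 < x θ := fun θ => hr0.trans_le (hx θ).1
    have ha0 : ∀ j t, 0 < (1 - l) * ap + l * a j t := fun j t => P.ham.trans_le (PH.ha j t).1
    rw [Real.norm_eq_abs, abs_of_nonneg (Finset.sum_nonneg fun j _ =>
      mul_nonneg (mul_nonneg (PH.hp j t).le (hx0 _).le) (exp_pos _).le)]
    calc _ ≤ ∑ j, ((1 - l) * (γ * δ t / m) + l * p j t) * R := by
          apply Finset.sum_le_sum
          intro j _
          have e1 : exp (-(((1 - l) * ap + l * a j t) * x ((t - σd j t : ℝ) : AddCircle ω))) ≤ 1 :=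
            exp_le_one_iff.2 (by
              have := mul_pos (ha0 j t) (hx0 ((t - σd j t : ℝ) : AddCircle ω))
              linarith)
          have e2 := PH.hp j t
          have e3 := hx0 ((t - τd j t : ℝ) : AddCircle ω)
          calc _ ≤ ((1 - l) * (γ * δ t / m) + l * p j t) * x ((t - τd j t : ℝ) : AddCircle ω) * 1 :=
                mul_le_mul_of_nonneg_left e1 (mul_nonneg e2.le e3.le)
            _ ≤ _ := by
                rw [mul_one]
                exact mul_le_mul_of_nonneg_left (hx _).2 e2.le
      _ ≤ _ := by
          rw [← Finset.sum_mul]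
          refine mul_le_mul_of_nonneg_right ((PH.hhi t).trans ?_) hR0.le
          exact mul_le_mul_of_nonneg_left (ht1 t) hγ.le
  · intro l hl x hx he θ
    obtain ⟨t, rfl⟩ := QuotientAddGroup.mk_surjective θ
    exact ⟨(P.homot hl).lo (hsol l x hx he) t, ((P.homot hl).hi (hsol l x hx he) t).le⟩
  · intro l hl x hx he z hz
    apply circle_ext
    refine (P.homot hl).lin_inj (hsol l x hx he) hK (circle_per z) ?_
    intro t
    have := hL (fderiv ℝ (Nn G H Pc Qc T S) (l, x) (0, z)) t
    rw [← hz, hNd] at this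
    exact this
  · refine ⟨ContinuousMap.const _ (log γ / ap), fun θ => div_pos hlog hap, ?_⟩
    set x0 : C(AddCircle ω, ℝ) := ContinuousMap.const _ (log γ / ap) with hx0
    have hv : ∀ t : ℝ, Nn G H Pc Qc T S (0, x0) (t : AddCircle ω) = δ t * (log γ / ap) := by
      intro t
      rw [hNt]
      have e : exp (-(ap * (log γ / ap))) = γ⁻¹ := by
        rw [mul_div_cancel₀ _ hap.ne', exp_neg, exp_log hγ]
      simp only [hx0, ContinuousMap.const_apply, sub_zero, one_mul, zero_mul, add_zero, e]
      rw [Finset.sum_const, Finset.card_univ, Fintype.card_fin, nsmul_eq_mul]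
      field_simp
    apply circle_ext
    intro t
    have := lin_unique P.D_pos P.hA P.hAper (z := fun t : ℝ => x0 (t : AddCircle ω) -
      L (Nn G H Pc Qc T S (0, x0)) (t : AddCircle ω)) (fun t => by
        simp only [AddCircle.coe_add_period]) (fun t => by
        have h1 := hL (Nn G H Pc Qc T S (0, x0)) t
        rw [hv] at h1
        refine ((hasDerivAt_const t (log γ / ap)).sub h1).congr_deriv ?_
        simp only [hx0, ContinuousMap.const_apply]
        ring) t
    linarith

lemma exists_ext {ω : ℝ} (hω : 0 < ω) {g : ℝ → ℝ} (hc : ContinuousOn g (Ici 0))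
    (hp : ∀ t ≥ (0:ℝ), g (t + ω) = g t) :
    ∃ G : ℝ → ℝ, Continuous G ∧ Function.Periodic G ω ∧ ∀ t ≥ (0:ℝ), G t = g t := by
  have : Fact (0 < ω) := ⟨hω⟩
  have hn : ∀ (n : ℕ) (t : ℝ), 0 ≤ t → g (t + n * ω) = g t := by
    intro n
    induction n with
    | zero => intro t _; simp
    | succ k ih =>
      intro t ht
      rw [← ih t ht, ← hp (t + k * ω) (by positivity)]
      congr 1
      push_cast
      ring
  have h1 : Continuous (AddCircle.liftIco ω 0 g) := by
    apply AddCircle.liftIco_zero_continuous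
    · have := hp 0 le_rfl
      rw [zero_add] at this
      exact this.symm
    · exact hc.mono Icc_subset_Ici_self
  refine ⟨fun t => AddCircle.liftIco ω 0 g (t : AddCircle ω),
    h1.comp (AddCircle.continuous_mk' ω), fun t => by simp only [AddCircle.coe_add_period], ?_⟩
  intro t ht
  set n := ⌊t / ω⌋₊ with hn'
  have e1 : (n : ℝ) ≤ t / ω := Nat.floor_le (by positivity)
  have e2 : t / ω < n + 1 := Nat.lt_floor_add_one _
  rw [le_div_iff₀ hω] at e1
  rw [div_lt_iff₀ hω] at e2
  have e3 : t - n * ω ∈ Ico (0:ℝ) (0 + ω) := ⟨by linarith, by linarith⟩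
  have e4 : ((t - n * ω : ℝ) : AddCircle ω) = (t : AddCircle ω) := by
    have := (Function.Periodic.sub_nat_mul_eq (f := fun t : ℝ => (t : AddCircle ω)) (c := ω)
      (fun t => AddCircle.coe_add_period ω t) n (x := t))
    exact this
  change AddCircle.liftIco ω 0 g (t : AddCircle ω) = _
  rw [← e4, AddCircle.liftIco_coe_apply e3, ← hn n _ e3.1]
  congr 1
  ring

lemma exists_nat_shift {ω : ℝ} (hω : 0 < ω) (t : ℝ) : ∃ n : ℕ, 0 ≤ t + n * ω := by
  obtain ⟨n, hn⟩ := exists_nat_ge (-t / ω)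
  rw [div_le_iff₀ hω] at hn
  exact ⟨n, by linarith⟩

section
variable {m : ℕ} {p a τd σd : Fin m → ℝ → ℝ} {δ A x xs : ℝ → ℝ} {ω D γ am ap τ ζ : ℝ}

lemma sol_pos (hp : ∀ j t, 0 < p j t) (hA : ∀ t, HasDerivAt A (δ t) t) (hτ : 0 ≤ τ)
    (hd : ∀ j, ∀ t ≥ (0:ℝ), (0 ≤ τd j t ∧ τd j t ≤ τ) ∧ (0 ≤ σd j t ∧ σd j t ≤ τ))
    (hx : IsPosSol m p a δ τd σd τ x) : ∀ t ≥ 0, 0 < x t := by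
  obtain ⟨hc, hneg, h0, hder⟩ := hx
  by_contra! hcon
  obtain ⟨t, ht, hxt⟩ := hcon
  set W := {u | u ∈ Icc 0 t ∧ x u ≤ 0} with hW
  have hcW : IsClosed W := by
    have h1 : ContinuousOn x (Icc 0 t) :=
      hc.mono fun u hu => show -τ ≤ u by linarith [hu.1]
    have := h1.preimage_isClosed_of_isClosed isClosed_Icc (isClosed_Iic (a := (0:ℝ)))
    exact this
  have hne : W.Nonempty := ⟨t, ⟨ht, le_rfl⟩, hxt⟩
  have hbd : BddBelow W := ⟨0, fun u hu => hu.1.1⟩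
  set s := sInf W with hs
  have hsW : s ∈ W := hcW.csInf_mem hne hbd
  have hs0 : 0 ≤ s := hsW.1.1
  have hlt : ∀ u, 0 ≤ u → u < s → 0 < x u := by
    intro u hu hus
    by_contra! h
    have : u ∈ W := ⟨⟨hu, hus.le.trans hsW.1.2⟩, h⟩
    exact absurd (csInf_le hbd this) (not_le.2 hus)
  have hAc : Continuous A := continuous_iff_continuousAt.2 fun t => (hA t).continuousAt
  have hE : ∀ u, 0 < u → HasDerivAt (fun t => x t * exp (A t))
      ((∑ j, p j u * x (u - τd j u) * exp (-(a j u * x (u - σd j u)))) * exp (A u)) u := by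
    intro u hu
    refine (((hder u hu.le).hasDerivAt (Ici_mem_nhds hu)).mul (hA u).exp).congr_deriv ?_
    ring
  have hmono : MonotoneOn (fun t => x t * exp (A t)) (Icc 0 s) := by
    apply monotoneOn_of_deriv_nonneg (convex_Icc 0 s)
    · refine ContinuousOn.mul (hc.mono fun u hu => show -τ ≤ u by linarith [hu.1]) ?_
      exact (continuous_exp.comp hAc).continuousOn
    · intro u hu
      rw [interior_Icc] at hu
      exact (hE u hu.1).differentiableAt.differentiableWithinAt
    · intro u hu
      rw [interior_Icc] at hu
      rw [(hE u hu.1).deriv]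
      apply mul_nonneg _ (exp_pos _).le
      apply Finset.sum_nonneg
      intro j _
      have h1 := (hd j u hu.1.le).1
      have h2 : 0 ≤ x (u - τd j u) := by
        rcases lt_or_ge (u - τd j u) 0 with h | h
        · exact hneg _ ⟨by linarith [hu.1], h⟩
        · exact (hlt _ h (by linarith [hu.2])).le
      exact mul_nonneg (mul_nonneg (hp j u).le h2) (exp_pos _).le
  have h1 := hmono (left_mem_Icc.2 hs0) (right_mem_Icc.2 hs0) hs0
  simp only at h1
  have h2 := mul_pos h0 (exp_pos (A 0))
  have h3 := mul_nonpos_of_nonpos_of_nonneg hsW.2 (exp_pos (A s)).le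
  linarith

theorem attract_of (P : PData m p a δ A ω D γ am ap)
    (hpc : ∀ j, Continuous (p j)) (hpp : ∀ j, Function.Periodic (p j) ω)
    (hac : ∀ j, Continuous (a j)) (happ : ∀ j, Function.Periodic (a j) ω)
    (hτc : ∀ j, Continuous (τd j)) (hτp : ∀ j, Function.Periodic (τd j) ω)
    (hσc : ∀ j, Continuous (σd j)) (hσp : ∀ j, Function.Periodic (σd j) ω)
    (hτ : 0 ≤ τ)
    (hd : ∀ j, ∀ t ≥ (0:ℝ), (0 ≤ τd j t ∧ τd j t ≤ τ) ∧ (0 ≤ σd j t ∧ σd j t ≤ τ))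
    (hζ0 : 0 ≤ ζ) (hζ : ∀ j t, A t - A (t - σd j t) ≤ ζ)
    (hK : ap / am * exp D * log γ * (exp (D + ζ) - 1) ≤ 1)
    (S : PSol m p a δ τd σd ω xs) (hx : IsPosSol m p a δ τd σd τ x) :
    Tendsto (fun t => x t - xs t) atTop (nhds 0) := by
  have hxpos := sol_pos P.hp P.hA hτ hd hx
  obtain ⟨hxc, hxneg, hx0, hxder⟩ := hx
  have hap : 0 < ap := P.ham.trans_le P.am_le_ap
  have hD := P.D_pos
  have hlog := P.logγ_pos
  have hxsc := S.cont
  set c : Fin m → ℝ → ℝ := fun j t =>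
    p j t * xs (t - τd j t) * exp (-(a j t * xs (t - σd j t))) / xs t with hc
  have hcpos : ∀ j t, 0 < c j t := fun j t =>
    div_pos (mul_pos (mul_pos (P.hp j t) (S.pos _)) (exp_pos _)) (S.pos t)
  have hcc : ∀ j, Continuous (c j) := fun j => by
    refine Continuous.div ?_ hxsc (fun t => (S.pos t).ne')
    have := hpc j; have := hac j; have := hτc j; have := hσc j
    fun_prop
  have hcp : ∀ j, Function.Periodic (c j) ω := fun j t => by
    have e1 : t + ω - τd j t = (t - τd j t) + ω := by ring
    have e2 : t + ω - σd j t = (t - σd j t) + ω := by ring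
    simp only [hc, hpp j t, happ j t, hτp j t, hσp j t, e1, e2, S.per _]
  choose tm htm using fun j => per_min P.hω (hcc j) (hcp j)
  obtain ⟨tM, htM⟩ := per_max P.hω (f := fun t => ∑ j, c j t)
    (continuous_finsetSum _ fun j _ => hcc j) (fun t => by simp only [hcp _ t])
  have hne : (Finset.univ : Finset (Fin m)).Nonempty := P.nonempty
  set c0 := Finset.univ.inf' hne (fun j => c j (tm j)) with hc0
  have hy : YSys m c (fun j t => a j t * xs (t - σd j t)) τd σd (fun t => x t / xs t)
      (fun t => xs t * exp (A t)) τ (ap / am * exp D * log γ) (D + ζ) c0 (∑ j, c j tM)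
      (am * (exp (-D) * (D / ap))) := by
    refine {
      hm := P.hm
      hτ := hτ
      hd := hd
      hs := by positivity
      hK := hK
      hc0 := ?_
      hb0 := ?_
      hc := ?_
      hC := ?_
      hb := ?_
      cont := ?_
      nonneg := ?_
      pos := ?_
      der := ?_
      Epos := ?_
      Eder := ?_
      Es := ?_
      }
    · rw [hc0, Finset.lt_inf'_iff]
      exact fun j _ => hcpos j _
    · exact mul_pos P.ham (by positivity)
    · exact fun j t _ => (Finset.inf'_le (fun j => c j (tm j)) (Finset.mem_univ j)).trans (htm j t)
    · exact fun t _ => htM t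
    · intro j t _
      constructor
      · exact mul_le_mul (P.ha j t).1 (P.lo S _) (by positivity) (P.ham.le.trans (P.ha j t).1)
      · have := mul_le_mul (P.ha j t).2 (P.hi S (t - σd j t)).le (S.pos _).le hap.le
        refine this.trans_eq ?_
        ring
    · exact hxc.div hxsc.continuousOn fun t _ => (S.pos t).ne'
    · intro t ht
      refine div_nonneg ?_ (S.pos t).le
      rcases lt_or_ge t 0 with h | h
      · exact hxneg t ⟨ht, h⟩
      · exact (hxpos t h).le
    · exact fun t ht => div_pos (hxpos t ht) (S.pos t)
    · intro t ht
      have h1 := ((hxder t ht.le).hasDerivAt (Ici_mem_nhds ht)).div (S.der t) (S.pos t).ne'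
      refine h1.congr_deriv ?_
      have hxt := (S.pos t).ne'
      have e0 : ∀ j, p j t * x (t - τd j t) * exp (-(a j t * x (t - σd j t))) =
          c j t * (x (t - τd j t) / xs (t - τd j t) *
            exp (-(a j t * xs (t - σd j t) * (x (t - σd j t) / xs (t - σd j t) - 1)))) * xs t := by
        intro j
        have n1 := (S.pos (t - τd j t)).ne'
        have n2 := (S.pos (t - σd j t)).ne'
        have e1 : -(a j t * xs (t - σd j t) * (x (t - σd j t) / xs (t - σd j t) - 1)) =
          -(a j t * x (t - σd j t)) + a j t * xs (t - σd j t) := by field_simp; ring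
        have e2 : exp (-(a j t * xs (t - σd j t))) * exp (a j t * xs (t - σd j t)) = 1 := by
          rw [← exp_add]; simp
        rw [e1, exp_add]
        simp only [hc]
        field_simp
        linear_combination (-(p j t * x (t - τd j t))) * e2
      have e3 : ∀ j, p j t * xs (t - τd j t) * exp (-(a j t * xs (t - σd j t))) =
          c j t * xs t := fun j => by simp only [hc]; field_simp
      simp only [e0, e3, mul_sub, Finset.sum_sub_distrib, ← Finset.sum_mul]
      field_simp
      ring
    · exact fun t _ => mul_pos (S.pos t) (exp_pos _)
    · intro t _
      refine (P.E_der S t).congr_deriv ?_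
      have hxt := (S.pos t).ne'
      have e3 : ∀ j, p j t * xs (t - τd j t) * exp (-(a j t * xs (t - σd j t))) =
          c j t * xs t := fun j => by simp only [hc]; field_simp
      simp only [e3, ← Finset.sum_mul]
      ring
    · intro t _ j
      have e1 := (P.osc S t (t - σd j t)).le
      have e2 : exp (A t) ≤ exp ζ * exp (A (t - σd j t)) := by
        rw [← exp_add]
        exact exp_le_exp.2 (by linarith [hζ j t])
      have := mul_le_mul e1 e2 (exp_pos _).le (mul_pos (exp_pos D) (S.pos _)).le
      refine this.trans_eq ?_
      rw [exp_add]
      ring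
  have hlim := hy.attract
  obtain ⟨tB, htB⟩ := per_max P.hω hxsc S.per
  have h1 : Tendsto (fun t => xs tB * |x t / xs t - 1|) atTop (nhds 0) := by
    have := ((hlim.sub_const 1).abs).const_mul (xs tB)
    simpa using this
  refine squeeze_zero_norm (fun t => ?_) h1
  have e : x t - xs t = xs t * (x t / xs t - 1) := by
    have := (S.pos t).ne'
    field_simp
  rw [e, norm_mul, Real.norm_eq_abs, Real.norm_eq_abs, abs_of_pos (S.pos t)]
  exact mul_le_mul_of_nonneg_right (htB t) (abs_nonneg _)
end


lemma IsPosSol.congr' {m : ℕ} {p a τd σd p' a' τd' σd' : Fin m → ℝ → ℝ} {δ δ' x : ℝ → ℝ} {τ : ℝ}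
    (hp : ∀ j, ∀ t ≥ (0:ℝ), p' j t = p j t) (ha : ∀ j, ∀ t ≥ (0:ℝ), a' j t = a j t)
    (hτ : ∀ j, ∀ t ≥ (0:ℝ), τd' j t = τd j t) (hσ : ∀ j, ∀ t ≥ (0:ℝ), σd' j t = σd j t)
    (hδ : ∀ t ≥ (0:ℝ), δ' t = δ t) (hx : IsPosSol m p a δ τd σd τ x) :
    IsPosSol m p' a' δ' τd' σd' τ x := by
  obtain ⟨h1, h2, h3, h4⟩ := hx
  refine ⟨h1, h2, h3, fun t ht => ?_⟩
  simp only [hp _ t ht, ha _ t ht, hτ _ t ht, hσ _ t ht, hδ t ht]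
  exact h4 t ht

lemma le_limsup_per {ω : ℝ} (hω : 0 < ω) {f F : ℝ → ℝ} (hF : Continuous F)
    (hp : Function.Periodic F ω) (he : ∀ᶠ t in atTop, f t = F t) (t : ℝ) :
    F t ≤ limsup f atTop := by
  rw [limsup_congr he]
  apply le_limsup_of_frequently_le
  · rw [frequently_atTop]
    intro b
    obtain ⟨n, hn⟩ := exists_nat_ge ((b - t) / ω)
    rw [div_le_iff₀ hω] at hn
    refine ⟨t + n * ω, by linarith, ?_⟩
    rw [hp.nat_mul n t]
  · obtain ⟨t1, h1⟩ := per_max hω hF hp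
    exact isBoundedUnder_of ⟨F t1, h1⟩

/-- For an ω-periodic equation (*) (all coefficient and delay functions
ω-periodic on `[0,∞)`), with `p(t) > δ(t)`, under (A0), condition (i)
`p(t) ≥ e^D δ(t)` on `[0,ω]` with `p ≢ e^D δ`, and condition (ii)
`(a⁺/a⁻) e^D (log γ)(e^{D+ζ⁺} - 1) ≤ 1`, there exists a positive ω-periodic solution
which attracts every positive solution. -/
theorem periodic_globally_attractive_solution
    (m : ℕ) (hm : 0 < m) (p a : Fin m → ℝ → ℝ) (δ : ℝ → ℝ)
    (τd σd : Fin m → ℝ → ℝ) (τ : ℝ)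
    (hA0 : HypA0 m p a δ τd σd) (hτ : IsMaxDelay m τd σd τ)
    (ω : ℝ) (hω : 0 < ω)
    (hper : ∀ t ≥ (0:ℝ), δ (t + ω) = δ t ∧ ∀ j : Fin m,
      p j (t + ω) = p j t ∧ a j (t + ω) = a j t ∧
      τd j (t + ω) = τd j t ∧ σd j (t + ω) = σd j t)
    (hpδ : ∀ t ≥ (0:ℝ), δ t < ∑ j, p j t)
    (aminus aplus : ℝ)
    (haminus : IsGLB {r : ℝ | ∃ j : Fin m, ∃ t : ℝ, 0 ≤ t ∧ r = a j t} aminus)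
    (haplus : IsLUB {r : ℝ | ∃ j : Fin m, ∃ t : ℝ, 0 ≤ t ∧ r = a j t} aplus)
    (D : ℝ) (hD : D = ∫ t in (0:ℝ)..ω, δ t)
    (γ : ℝ) (hγ : IsGreatest ((fun t => (∑ j, p j t) / δ t) '' Icc (0:ℝ) ω) γ)
    (ζplus : ℝ)
    (hζ : IsGreatest {r : ℝ | ∃ j : Fin m,
        r = Filter.limsup (fun t => ∫ s in (t - σd j t)..t, δ s) Filter.atTop} ζplus)
    (hi : (∀ t ∈ Icc (0:ℝ) ω, Real.exp D * δ t ≤ ∑ j, p j t) ∧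
      ¬(∀ t ∈ Icc (0:ℝ) ω, (∑ j, p j t) = Real.exp D * δ t))
    (hii : (aplus / aminus) * Real.exp D * Real.log γ * (Real.exp (D + ζplus) - 1) ≤ 1) :
    ∃ xstar : ℝ → ℝ, IsPosSol m p a δ τd σd τ xstar ∧
      (∀ t ≥ -τ, 0 < xstar t) ∧
      (∀ t ≥ -τ, xstar (t + ω) = xstar t) ∧
      ∀ x : ℝ → ℝ, IsPosSol m p a δ τd σd τ x →
        Filter.Tendsto (fun t => x t - xstar t) Filter.atTop (nhds 0) := by
  obtain ⟨hp, ha, hδ, hdel⟩ := hA0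
  choose P hPc hPp hPe using fun j => exists_ext hω (hp j).1 (fun t ht => ((hper t ht).2 j).1)
  choose Q hQc hQp hQe using fun j => exists_ext hω (ha j).1 (fun t ht => ((hper t ht).2 j).2.1)
  choose T hTc hTp hTe using fun j =>
    exists_ext hω (hdel j).1 (fun t ht => ((hper t ht).2 j).2.2.1)
  choose S hSc hSp hSe using fun j =>
    exists_ext hω (hdel j).2.1 (fun t ht => ((hper t ht).2 j).2.2.2)
  obtain ⟨d, hdc, hdp, hde⟩ := exists_ext hω hδ.1 (fun t ht => (hper t ht).1)
  have hPpos : ∀ j t, 0 < P j t := by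
    intro j t
    obtain ⟨n, hn⟩ := exists_nat_shift hω t
    rw [← (hPp j).nat_mul n t, hPe j _ hn]
    exact (hp j).2 _ hn
  have hdpos : ∀ t, 0 < d t := by
    intro t
    obtain ⟨n, hn⟩ := exists_nat_shift hω t
    rw [← hdp.nat_mul n t, hde _ hn]
    exact hδ.2 _ hn
  have hSpos : ∀ j t, 0 ≤ S j t := by
    intro j t
    obtain ⟨n, hn⟩ := exists_nat_shift hω t
    rw [← (hSp j).nat_mul n t, hSe j _ hn]
    exact ((hdel j).2.2.1 _ hn).2
  have hdl : ∀ j, ∀ t ≥ (0:ℝ), (0 ≤ T j t ∧ T j t ≤ τ) ∧ (0 ≤ S j t ∧ S j t ≤ τ) := by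
    intro j t ht
    rw [hTe j t ht, hSe j t ht]
    have h1 := (hdel j).2.2.1 t ht
    exact ⟨⟨h1.1, hτ.1 ⟨j, t, ht, Or.inl rfl⟩⟩, ⟨h1.2, hτ.1 ⟨j, t, ht, Or.inr rfl⟩⟩⟩
  have j0 : Fin m := ⟨0, hm⟩
  have hτ0 : 0 ≤ τ := (hdl j0 0 le_rfl).1.1.trans (hdl j0 0 le_rfl).1.2
  -- bounds on a
  have ham : 0 < aminus := by
    choose cl cu hcl using fun j => (ha j).2
    have hne : (Finset.univ : Finset (Fin m)).Nonempty := ⟨j0, Finset.mem_univ _⟩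
    have h1 : 0 < Finset.univ.inf' hne cl := by
      rw [Finset.lt_inf'_iff]
      exact fun j _ => (hcl j).1
    refine h1.trans_le (haminus.2 ?_)
    rintro _ ⟨j, t, ht, rfl⟩
    exact (Finset.inf'_le cl (Finset.mem_univ j)).trans ((hcl j).2 t ht).1
  have hQb : ∀ j t, aminus ≤ Q j t ∧ Q j t ≤ aplus := by
    intro j t
    obtain ⟨n, hn⟩ := exists_nat_shift hω t
    rw [← (hQp j).nat_mul n t, hQe j _ hn]
    exact ⟨haminus.1 ⟨j, _, hn, rfl⟩, haplus.1 ⟨j, _, hn, rfl⟩⟩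
  set A : ℝ → ℝ := fun t => ∫ s in (0:ℝ)..t, d s with hA
  have hAd : ∀ t, HasDerivAt A (d t) t := fun t =>
    intervalIntegral.integral_hasDerivAt_right (hdc.intervalIntegrable 0 t)
      (hdc.stronglyMeasurableAtFilter _ _) hdc.continuousAt
  have hAc : Continuous A := continuous_iff_continuousAt.2 fun t => (hAd t).continuousAt
  have hAint : ∀ u v : ℝ, A v - A u = ∫ s in u..v, d s := fun u v =>
    intervalIntegral.integral_interval_sub_left (hdc.intervalIntegrable _ _)
      (hdc.intervalIntegrable _ _)
  have hItg : ∀ u v : ℝ, 0 ≤ u → 0 ≤ v → ∫ s in u..v, δ s = A v - A u := by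
    intro u v hu hv
    rw [hAint]
    apply intervalIntegral.integral_congr
    intro s hs
    have : 0 ≤ s := (le_inf hu hv).trans hs.1
    exact (hde s this).symm
  have hDA : D = A ω := by
    rw [hD, hItg 0 ω le_rfl hω.le]
    simp [hA]
  have hAper : ∀ t, A (t + ω) = A t + D := by
    intro t
    have h1 := hAint t (t + ω)
    rw [hdp.intervalIntegral_add_eq t 0, zero_add] at h1
    have h2 : A ω = ∫ s in (0:ℝ)..ω, d s := rfl
    linarith
  have hred : ∀ t, ∃ u ∈ Icc (0:ℝ) ω, d t = δ u ∧ ∑ j, P j t = ∑ j, p j u := by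
    intro t
    obtain ⟨k, hk, -⟩ := existsUnique_add_zsmul_mem_Ico hω t 0
    rw [zero_add] at hk
    refine ⟨t + k • ω, ⟨hk.1, hk.2.le⟩, ?_, ?_⟩
    · rw [← hde _ hk.1, hdp.zsmul k t]
    · refine Finset.sum_congr rfl fun j _ => ?_
      rw [← hPe j _ hk.1, (hPp j).zsmul k t]
  have PD : PData m P Q d A ω D γ aminus aplus := by
    refine ⟨hm, hω, hPpos, hdpos, hAd, hAper, ham, hQb, fun t => ?_, fun t => ?_⟩
    · obtain ⟨u, hu, h1, h2⟩ := hred t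
      rw [h1, h2]
      exact hi.1 u hu
    · obtain ⟨u, hu, h1, h2⟩ := hred t
      rw [h1, h2]
      have := hγ.2 ⟨u, hu, rfl⟩
      exact (div_le_iff₀ (hδ.2 u hu.1)).1 this
  -- the constant ζ
  have hζb : ∀ j t, A t - A (t - S j t) ≤ ζplus := by
    intro j t
    refine le_trans ?_ (hζ.2 ⟨j, rfl⟩)
    refine le_limsup_per hω (F := fun t => A t - A (t - S j t)) ?_ ?_ ?_ t
    · have := hSc j
      fun_prop
    · intro t
      have e : t + ω - S j t = (t - S j t) + ω := by ring
      simp only [hSp j t, e, hAper]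
      ring
    · filter_upwards [eventually_ge_atTop τ] with t ht
      have ht0 := hτ0.trans ht
      have h1 := (hdl j t ht0).2
      rw [← hSe j t ht0, hItg _ _ (by linarith) ht0]
  have hζ0 : 0 ≤ ζplus := by
    refine le_trans ?_ (hζb j0 0)
    rw [hAint]
    exact intervalIntegral.integral_nonneg (by linarith [hSpos j0 0]) fun u _ => (hdpos u).le
  have hlog := PD.logγ_pos
  have hap : 0 < aplus := ham.trans_le PD.am_le_ap
  have hK : aplus / aminus * exp D * log γ * (exp D - 1) ≤ 1 := by
    refine le_trans ?_ hii
    have : exp D ≤ exp (D + ζplus) := exp_le_exp.2 (by linarith)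
    have h2 : 0 ≤ aplus / aminus * exp D * log γ := by positivity
    exact mul_le_mul_of_nonneg_left (by linarith) h2
  obtain ⟨xs, hxs⟩ := PD.exists_sol hPc hPp hQc hQp hTc hTp hSc hSp hdc hdp hK
  refine ⟨xs, ?_, fun t _ => hxs.pos t, fun t _ => hxs.per t, fun x hx => ?_⟩
  · apply IsPosSol.congr' (fun j t ht => (hPe j t ht).symm) (fun j t ht => (hQe j t ht).symm)
      (fun j t ht => (hTe j t ht).symm) (fun j t ht => (hSe j t ht).symm)
      (fun t ht => (hde t ht).symm)
    exact ⟨hxs.cont.continuousOn, fun t _ => (hxs.pos t).le, hxs.pos 0,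
      fun t _ => (hxs.der t).hasDerivWithinAt⟩
  · exact attract_of PD hPc hPp hQc hQp hTc hTp hSc hSp hτ0 hdl hζ0 hζb hii hxs
      (hx.congr' hPe hQe hTe hSe hde)
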